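/- Let G be the non quasi-split unramified unitary group in four variables over F_0, m ≥ 1, n = 6m−3, Λ = Λ_4, and β = ϖ^{−m}(Y E_23 − ϖ Ȳ E_32) with Y ∈ o_F^×; set J = (1 + 𝔍_+) ∩ G (here J = J_+ since n is odd), J' = P_n(Λ) ∩ B where B is the M_4(F)-centralizer of β, and let s_1 = E_14 + E_22 + E_33 + E_41 and s_2 = ϖ^{-1}E_14 + E_22 + E_33 + ϖE_41 (elements of G_E = G ∩ B). Then for every integer t ≥ 0: (i) [J'(s_1s_2)^t J' : J'] = [J'(s_1s_2)^t s_1 J' : J'] = [J'(s_2s_1)^t J' : J'] = q^{2t} and [J'(s_2s_1)^t s_2 J' : J'] = q^{2(t+1)}; (ii) [J(s_1s_2)^t J : J] = [J(s_2s_1)^t J : J] = [J(s_1s_2)^t s_1 J : J] = q^{6t} and [J(s_2s_1)^t s_2 J : J] = q^{6(t+1)}, where q is the cardinality of the residue field of F_0 and [KgK : K] = [K : K ∩ gKg^{-1}]. -/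

import Mathlib

/-!
Common framework for formalizing statements from
"Representations of non quasi-split U(4) over a p-adic field I" (M. Miyauchi).

We model the non-archimedean local field `F` with its (possibly trivial) Galois
involution, ring of integers `O`, uniformizer `ϖ`, a finite-dimensional hermitian
space `(V, h)` over `F`, the adjoint involution `σA` on `A = End_F V`, the unitary
group `G = {g ∈ A^× | g σ(g) = 1}` (as a subgroup of `Aˣ`), self-dual lattice
sequences, the filtrations `a_n(Λ)`, the congruence subsets `P_n(Λ)`, skew
(semisimple) strata, characters attached to strata, smooth representations, and
Hecke algebras.
-/

noncomputable section
open scoped Classical Pointwise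

universe u v w

/-- The ambient data: a field `F` with involution `conj` (Galois involution of
`F/F₀`), ring of integers `O` (a valuation subring with uniformizer `ϖ` and finite
residue field), a hermitian space `(V, h)` and the adjoint involution `σA` on
`End_F V` induced by `h`. -/
structure USetting (F : Type u) [Field F] (V : Type v) [AddCommGroup V] [Module F V] where
  /-- the Galois involution `x ↦ x̄` on `F` -/
  conj : F ≃+* F
  conj_invol : ∀ x : F, conj (conj x) = x
  /-- the ring of integers `o_F` -/
  O : Subring F
  /-- a uniformizer `ϖ_F` -/
  ϖ : F
  ϖ_mem : ϖ ∈ O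
  ϖ_ne_zero : ϖ ≠ 0
  ϖ_not_unit : ∀ y ∈ O, ϖ * y ≠ 1
  conj_O : ∀ x ∈ O, conj x ∈ O
  /-- `O` is a valuation ring of `F` -/
  O_val : ∀ x : F, x ≠ 0 → x ∈ O ∨ x⁻¹ ∈ O
  /-- every nonunit of `O` is divisible by `ϖ`: the maximal ideal is `ϖO` -/
  unif : ∀ x ∈ O, (∀ y ∈ O, x * y ≠ 1) → ∃ z ∈ O, x = ϖ * z
  /-- the residue field `o_F/p_F` is finite -/
  res_fin : Finite (O ⧸ (Ideal.span {(⟨ϖ, ϖ_mem⟩ : O)} : Ideal O))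
  /-- the hermitian form `h` on `V` -/
  h : V → V → F
  h_add_left : ∀ u v w : V, h (u + v) w = h u w + h v w
  h_smul_left : ∀ (c : F) (u w : V), h (c • u) w = conj c * h u w
  h_conj_symm : ∀ u w : V, h w u = conj (h u w)
  h_nondeg : ∀ u : V, (∀ w : V, h u w = 0) → u = 0
  /-- the involution on `A = End_F V` induced by `h` -/
  σA : Module.End F V → Module.End F V
  σA_adj : ∀ (X : Module.End F V) (u w : V), h (X u) w = h u (σA X w)
  σA_one : σA 1 = 1
  σA_mul : ∀ X Y, σA (X * Y) = σA Y * σA X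
  σA_add : ∀ X Y, σA (X + Y) = σA X + σA Y
  σA_invol : ∀ X, σA (σA X) = X

namespace USetting

variable {F : Type u} [Field F] {V : Type v} [AddCommGroup V] [Module F V]
variable (S : USetting F V)

/-- the maximal ideal `p_F = ϖ o_F` of `o_F`, as a subset of `F` -/
def pF : Set F := {y : F | ∃ z ∈ S.O, y = S.ϖ * z}

/-- the residue characteristic of `F` -/
def residueChar : ℕ :=
  ringChar (S.O ⧸ (Ideal.span {(⟨S.ϖ, S.ϖ_mem⟩ : S.O)} : Ideal S.O))

/-- An `o_F`-lattice sequence in `V`: a decreasing `ℤ`-indexed family of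
`o_F`-submodules of `V`, periodic with (minimal) period `e` under multiplication
by `ϖ`. -/
structure LatSeq where
  L : ℤ → Set V
  zero_mem : ∀ i, (0 : V) ∈ L i
  add_mem : ∀ i, ∀ v w : V, v ∈ L i → w ∈ L i → v + w ∈ L i
  smul_mem : ∀ i, ∀ c ∈ S.O, ∀ v ∈ L i, c • v ∈ L i
  dec : ∀ i, L (i + 1) ⊆ L i
  e : ℤ
  e_pos : 0 < e
  periodic : ∀ i, L (i + e) = S.ϖ • L i
  e_min : ∀ e' : ℤ, 0 < e' → (∀ i, L (i + e') = S.ϖ • L i) → e ≤ e'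

/-- each member of the sequence is a full `o_F`-lattice in `V`
(finitely generated over `o_F` and spanning `V` over `F`) -/
def IsFull (Λ : S.LatSeq) : Prop :=
  ∀ i : ℤ, Submodule.span F (Λ.L i) = ⊤ ∧
    ∃ s : Finset V, ↑s ⊆ Λ.L i ∧
      ∀ v ∈ Λ.L i, ∃ c : V → F, (∀ w ∈ s, c w ∈ S.O) ∧ v = ∑ w ∈ s, c w • w

/-- the filtration `a_n(Λ)` of `A = End_F V` -/
def aFil (Λ : S.LatSeq) (n : ℤ) : Set (Module.End F V) :=
  {X : Module.End F V | ∀ i : ℤ, ∀ v ∈ Λ.L i, X v ∈ Λ.L (i + n)}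

/-- `A_- = {X ∈ A | X + σ(X) = 0}` -/
def Aminus : Set (Module.End F V) := {X | S.σA X = -X}

/-- the dual lattice `L^# = {v | h(v, L) ⊆ o_F}` -/
def dualLat (L : Set V) : Set V := {v : V | ∀ w ∈ L, S.h v w ∈ S.O}

/-- `Λ` is self-dual with duality invariant `d`: `Λ(i)^# = Λ(d - i)` -/
def selfDualWith (Λ : S.LatSeq) (d : ℤ) : Prop :=
  ∀ i : ℤ, S.dualLat (Λ.L i) = Λ.L (d - i)

def isSelfDual (Λ : S.LatSeq) : Prop := ∃ d : ℤ, S.selfDualWith Λ d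

/-- the unitary group `G = {g ∈ A^× | g σ(g) = 1}` as a subgroup of `Aˣ` -/
def GU : Subgroup (Module.End F V)ˣ where
  carrier := {u : (Module.End F V)ˣ |
    S.σA (u : Module.End F V) = ((u⁻¹ : (Module.End F V)ˣ) : Module.End F V)}
  one_mem' := by simpa using S.σA_one
  mul_mem' := by
    intro a b ha hb
    simp only [Set.mem_setOf_eq] at *
    rw [Units.val_mul, S.σA_mul, ha, hb, mul_inv_rev, Units.val_mul]
  inv_mem' := by
    intro a ha
    simp only [Set.mem_setOf_eq] at *
    rw [← ha, S.σA_invol, inv_inv]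

/-- the underlying endomorphism of an element of `G` -/
def toE (g : S.GU) : Module.End F V := ((g : (Module.End F V)ˣ) : Module.End F V)

/-- `P_k(Λ) = G ∩ (1 + a_k(Λ))` (for `k ≥ 1`) -/
def Pset (Λ : S.LatSeq) (k : ℤ) : Set S.GU := {g : S.GU | S.toE g - 1 ∈ S.aFil Λ k}

/-- `P_0(Λ) = G ∩ a_0(Λ)` -/
def P0set (Λ : S.LatSeq) : Set S.GU := {g : S.GU | S.toE g ∈ S.aFil Λ 0}

/-- `B`, the `A`-centralizer of `β` -/
def Bcent (β : Module.End F V) : Set (Module.End F V) := {X | X * β = β * X}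

/-- `B^⊥`, the orthogonal complement of `B` in `A` w.r.t. the pairing `(x,y) ↦ tr_{A/F}(xy)` -/
def Bperp (β : Module.End F V) : Set (Module.End F V) :=
  {X | ∀ Y ∈ Bcent β, LinearMap.trace F V (X * Y) = 0}

/-- sum of two subsets of `A` -/
def setAdd (s t : Set (Module.End F V)) : Set (Module.End F V) :=
  {z | ∃ x ∈ s, ∃ y ∈ t, z = x + y}

/-- `𝔍 = a'_n ⊕ a^⊥_{[(n+1)/2]}` -/
def frakJ (Λ : S.LatSeq) (n : ℤ) (β : Module.End F V) : Set (Module.End F V) :=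
  setAdd (S.aFil Λ n ∩ Bcent β) (S.aFil Λ ((n + 1) / 2) ∩ Bperp β)

/-- `𝔍₊ = a'_n ⊕ a^⊥_{[n/2]+1}` -/
def frakJplus (Λ : S.LatSeq) (n : ℤ) (β : Module.End F V) : Set (Module.End F V) :=
  setAdd (S.aFil Λ n ∩ Bcent β) (S.aFil Λ (n / 2 + 1) ∩ Bperp β)

/-- `J = (1 + 𝔍) ∩ G` -/
def Jset (Λ : S.LatSeq) (n : ℤ) (β : Module.End F V) : Set S.GU :=
  {g : S.GU | S.toE g - 1 ∈ S.frakJ Λ n β}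

/-- `J₊ = (1 + 𝔍₊) ∩ G` -/
def Jplusset (Λ : S.LatSeq) (n : ℤ) (β : Module.End F V) : Set S.GU :=
  {g : S.GU | S.toE g - 1 ∈ S.frakJplus Λ n β}

/-- `G_E = G ∩ B`, the `G`-centralizer of `β` -/
def GEset (β : Module.End F V) : Set S.GU := {g : S.GU | S.toE g ∈ Bcent β}

/-- the set `J G_E J` -/
def JGEJ (Λ : S.LatSeq) (n : ℤ) (β : Module.End F V) : Set S.GU :=
  {a : S.GU | ∃ j₁ ∈ S.Jset Λ n β, ∃ c ∈ S.GEset β, ∃ j₂ ∈ S.Jset Λ n β, a = j₁ * c * j₂}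

/-- `ν_Λ(X) = k`, i.e. `X ∈ a_k(Λ) \ a_{k+1}(Λ)` -/
def HasVal (Λ : S.LatSeq) (X : Module.End F V) (k : ℤ) : Prop :=
  X ∈ S.aFil Λ k ∧ X ∉ S.aFil Λ (k + 1)

/-- `y_β = ϖ^{n/k} β^{e/k}` where `k = gcd(e(Λ), n)` -/
def ybeta (Λ : S.LatSeq) (n : ℤ) (β : Module.End F V) : Module.End F V :=
  S.ϖ ^ ((n / (Int.gcd Λ.e n : ℤ)).toNat) • β ^ ((Λ.e / (Int.gcd Λ.e n : ℤ)).toNat)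

/-- two polynomials over `F` with integral coefficients are coprime modulo `p_F` -/
def CoprimeModP (f g : Polynomial F) : Prop :=
  ∃ u v : Polynomial F, (∀ i, u.coeff i ∈ S.O) ∧ (∀ i, v.coeff i ∈ S.O) ∧
    ∀ i, (u * f + v * g - 1).coeff i ∈ S.pF

/-- the filtration `a_m(Λ ∩ U)` on `End_F(U)` cut out by a subspace `U ⊆ V` -/
def aFilOn (Λ : S.LatSeq) (U : Submodule F V) (m : ℤ) : Set (Module.End F U) :=
  {X : Module.End F U | ∀ i : ℤ, ∀ v : U, (v : V) ∈ Λ.L i → ((X v : U) : V) ∈ Λ.L (i + m)}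

def HasValOn (Λ : S.LatSeq) (U : Submodule F V) (X : Module.End F U) (k : ℤ) : Prop :=
  X ∈ S.aFilOn Λ U k ∧ X ∉ S.aFilOn Λ U (k + 1)

/-- `x` is integral over `o_F` -/
def IsIntegralO {R : Type*} [Ring R] [Algebra F R] (x : R) : Prop :=
  ∃ p : Polynomial F, p.Monic ∧ (∀ i, p.coeff i ∈ S.O) ∧ Polynomial.aeval x p = 0

/-- `[Λ|U, n, n-1, βU]` is a simple stratum: `E = F[βU]` is a field, `Λ|U` is an
`o_E`-lattice sequence, `ν(βU) = -n`, and `βU` is minimal over `F` (expressed by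
the standard equivalent exactness property of `ad(βU)`, cf. Bushnell–Kutzko
(1.4.9), (1.4.15)). -/
def SimpleOn (Λ : S.LatSeq) (n : ℤ) (U : Submodule F V) (βU : Module.End F U) : Prop :=
  IsField (Algebra.adjoin F ({βU} : Set (Module.End F U))) ∧
  (∀ x : Module.End F U, x ∈ Algebra.adjoin F ({βU} : Set (Module.End F U)) →
      S.IsIntegralO x → ∀ i : ℤ, ∀ v : U, (v : V) ∈ Λ.L i → ((x v : U) : V) ∈ Λ.L i) ∧
  S.HasValOn Λ U βU (-n) ∧
  (∀ m : ℤ, ∀ X ∈ S.aFilOn Λ U m, βU * X - X * βU ∈ S.aFilOn Λ U (m - n + 1) →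
      ∃ Y : Module.End F U, Y * βU = βU * Y ∧ X - Y ∈ S.aFilOn Λ U (m + 1))

/-- `E = F[βU]` is tamely ramified over `F`: the ramification index
`e(E/F) = e(Λ)/g`, where `g` generates the value group `ν_Λ(E^×)`, is prime to
the residue characteristic. -/
def TameOn (Λ : S.LatSeq) (U : Submodule F V) (βU : Module.End F U) : Prop :=
  ∃ g : ℤ, 0 < g ∧
    (∀ x : Module.End F U, x ∈ Algebra.adjoin F ({βU} : Set (Module.End F U)) → x ≠ 0 →
        ∃ m : ℤ, g ∣ m ∧ S.HasValOn Λ U x m) ∧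
    (∃ x : Module.End F U, x ∈ Algebra.adjoin F ({βU} : Set (Module.End F U)) ∧
        S.HasValOn Λ U x g) ∧
    ¬ ((S.residueChar : ℤ) ∣ (Λ.e / g))

/-- restriction of an endomorphism to an invariant subspace -/
def restr (β : Module.End F V) (U : Submodule F V) (hU : ∀ v ∈ U, β v ∈ U) :
    Module.End F U :=
  LinearMap.restrict β hU

lemma pow_inv (β : Module.End F V) (U : Submodule F V) (hU : ∀ v ∈ U, β v ∈ U) :
    ∀ m : ℕ, ∀ v ∈ U, (β ^ m) v ∈ U := by
  intro m
  induction m with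
  | zero => intro v hv; simpa using hv
  | succ t ih =>
      intro v hv
      rw [pow_succ]
      exact ih _ (hU v hv)

lemma ybeta_inv (Λ : S.LatSeq) (n : ℤ) (β : Module.End F V) (U : Submodule F V)
    (hU : ∀ v ∈ U, β v ∈ U) : ∀ v ∈ U, S.ybeta Λ n β v ∈ U := by
  intro v hv
  show (S.ϖ ^ ((n / (Int.gcd Λ.e n : ℤ)).toNat) •
      β ^ ((Λ.e / (Int.gcd Λ.e n : ℤ)).toNat)) v ∈ U
  rw [LinearMap.smul_apply]
  exact U.smul_mem _ (pow_inv β U hU _ v hv)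

variable [FiniteDimensional F V]

/-- `[Λ, n, n-1, β]` is a skew semisimple stratum, split with respect to the
orthogonal `F`-splitting `V = W 0 ⊥ … ⊥ W (k-1)`: `Λ` is a full self-dual
lattice sequence, `β` is skew with `ν_Λ(β) = -n`, the splitting is orthogonal,
compatible with `Λ` and preserved by `β`, each restricted stratum is zero or
simple, no characteristic polynomial of a nonzero component is divisible by `X`
mod `p_F`, and the characteristic polynomials of distinct components are
coprime mod `p_F`. -/
structure IsSkewSS (Λ : S.LatSeq) (n : ℤ) (β : Module.End F V)
    (k : ℕ) (W : Fin k → Submodule F V) : Prop where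
  full : S.IsFull Λ
  selfdual : S.isSelfDual Λ
  n_pos : 0 < n
  skew : β ∈ S.Aminus
  mem : β ∈ S.aFil Λ (-n)
  val : β ∉ S.aFil Λ (1 - n)
  k_pos : 0 < k
  internal : DirectSum.IsInternal W
  orth : ∀ i j, i ≠ j → ∀ v ∈ W i, ∀ w ∈ W j, S.h v w = 0
  lat_compat : ∀ m : ℤ, ∀ f : Fin k → V, (∀ i, f i ∈ W i) →
      ((∑ i, f i) ∈ Λ.L m ↔ ∀ i, f i ∈ Λ.L m)
  β_inv : ∀ i, ∀ v ∈ W i, β v ∈ W i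
  comp : ∀ i, (∀ v ∈ W i, β v = 0) ∨ S.SimpleOn Λ n (W i) (restr β (W i) (β_inv i))
  comp_nondeg : ∀ i, ¬ (∀ v ∈ W i, β v = 0) →
      (LinearMap.charpoly
        (restr (S.ybeta Λ n β) (W i) (S.ybeta_inv Λ n β (W i) (β_inv i)))).coeff 0 ∉ S.pF
  coprime : ∀ i j, i ≠ j →
      S.CoprimeModP
        (LinearMap.charpoly
          (restr (S.ybeta Λ n β) (W i) (S.ybeta_inv Λ n β (W i) (β_inv i))))
        (LinearMap.charpoly
          (restr (S.ybeta Λ n β) (W j) (S.ybeta_inv Λ n β (W j) (β_inv j))))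

/-- the stratum `[Λ, n, n-1, β]` is fundamental: the reduction mod `p_F` of the
characteristic polynomial of `y_β` is not `X^N` -/
def IsFundamental (Λ : S.LatSeq) (n : ℤ) (β : Module.End F V) : Prop :=
  ¬ ∀ i : ℕ, i < Module.finrank F V →
      (LinearMap.charpoly (S.ybeta Λ n β)).coeff i ∈ S.pF

section Char

variable (F₀ : Type w) [Field F₀] [Algebra F₀ F]

/-- `tr_{A/F₀} = tr_{F/F₀} ∘ tr_{A/F}` -/
def trA0 (X : Module.End F V) : F₀ := Algebra.trace F₀ F (LinearMap.trace F V X)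

/-- the character `ψ_β(x) = ψ₀(tr_{A/F₀}(β(x-1)))` -/
def psiCh (ψ₀ : F₀ → ℂ) (β : Module.End F V) (g : S.GU) : ℂ :=
  ψ₀ (trA0 F₀ (β * (S.toE g - 1)))

/-- `ψ₀` is an additive character of `F₀` with conductor `p₀` -/
def IsAddCh (ψ₀ : F₀ → ℂ) : Prop :=
  (∀ x y : F₀, ψ₀ (x + y) = ψ₀ x * ψ₀ y) ∧
  (∀ x : F₀, algebraMap F₀ F x ∈ S.pF → ψ₀ x = 1) ∧
  (∃ x : F₀, algebraMap F₀ F x ∈ S.O ∧ ψ₀ x ≠ 1)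

/-- `F₀` is the fixed field of the involution -/
def FixedField : Prop := ∀ x : F, S.conj x = x ↔ x ∈ (algebraMap F₀ F).range

end Char

section Rep

variable {W : Type*} [AddCommGroup W] [Module ℂ W]

/-- smoothness of a representation of `G` (relative to the lattice sequence `Λ`:
the groups `P_k(Λ)`, `k ≥ 1`, form a basis of neighborhoods of the identity) -/
def SmoothRel (Λ : S.LatSeq) (π : S.GU →* Module.End ℂ W) : Prop :=
  ∀ w : W, ∃ k : ℤ, 1 ≤ k ∧ ∀ g ∈ S.Pset Λ k, π g w = w

/-- smoothness of a representation of `G` -/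
def Smooth (π : S.GU →* Module.End ℂ W) : Prop :=
  ∀ w : W, ∃ Λ : S.LatSeq, S.IsFull Λ ∧ S.isSelfDual Λ ∧
    ∃ k : ℤ, 1 ≤ k ∧ ∀ g ∈ S.Pset Λ k, π g w = w

/-- irreducibility -/
def Irred (π : S.GU →* Module.End ℂ W) : Prop :=
  (∃ w : W, w ≠ 0) ∧
  ∀ U : Submodule ℂ W, (∀ g : S.GU, ∀ w ∈ U, π g w ∈ U) → U = ⊥ ∨ U = ⊤

/-- `π` contains the character `χ` of the subset `K ⊆ G` -/
def ContainsChar (π : S.GU →* Module.End ℂ W) (K : Set S.GU) (χ : S.GU → ℂ) : Prop :=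
  ∃ w : W, w ≠ 0 ∧ ∀ g ∈ K, π g w = χ g • w

/-- `π` has positive level: no nonzero `P_1(Λ)`-fixed vector for any self-dual `Λ` -/
def PositiveLevel (π : S.GU →* Module.End ℂ W) : Prop :=
  ∀ Λ : S.LatSeq, S.IsFull Λ → S.isSelfDual Λ →
    ∀ w : W, (∀ g ∈ S.Pset Λ 1, π g w = w) → w = 0

end Rep

section Hecke

/-- the double coset `KgK` -/
def dCoset (K : Subgroup S.GU) (g : S.GU) : Set S.GU :=
  {a : S.GU | ∃ x ∈ K, ∃ y ∈ K, a = x * g * y}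

/-- the double coset `KgK` for a subset `K` -/
def dCosetSet (K : Set S.GU) (g : S.GU) : Set S.GU :=
  {a : S.GU | ∃ x ∈ K, ∃ y ∈ K, a = x * g * y}

/-- convolution of two functions on `G` relative to the open compact subgroup `K`
(Haar measure normalized by `vol(K) = 1`):
`(f₁ * f₂)(g) = ∑_{xK ∈ G/K} f₁(x) f₂(x⁻¹ g)`. -/
def hConv {M : Type*} [Ring M] (K : Subgroup S.GU) (f₁ f₂ : S.GU → M) : S.GU → M :=
  fun g => ∑ᶠ q : S.GU ⧸ K, f₁ (Quotient.out q) * f₂ ((Quotient.out q)⁻¹ * g)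

/-- `f` belongs to the Hecke algebra `H(G//K, τ)` with support contained in `supp`:
`f(kgk') = τ(k) f(g) τ(k')` for `k, k' ∈ K`, and `f` is compactly supported
(its support meets only finitely many cosets of `K`). -/
def IsHecke {M : Type*} [Ring M] (K : Subgroup S.GU) (supp : Set S.GU)
    (τ : S.GU → M) (f : S.GU → M) : Prop :=
  (∀ k ∈ K, ∀ g : S.GU, ∀ k' ∈ K, f (k * g * k') = τ k * f g * τ k') ∧
  Function.support f ⊆ supp ∧
  ((fun a : S.GU => (QuotientGroup.mk a : S.GU ⧸ K)) '' Function.support f).Finite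

/-- `[KgK : K] = [K : K ∩ gKg⁻¹]`, the number of left cosets of `K` in `KgK` -/
def dcIndex (K : Subgroup S.GU) (g : S.GU) : ℕ :=
  Nat.card ((fun a : S.GU => (QuotientGroup.mk a : S.GU ⧸ K)) '' S.dCoset K g)

end Hecke


section U4

/-! Concrete data for the non quasi-split unramified unitary group in four
variables: `V = F^4`, `h(v,w) = ᵗv̄ H w` with `H = E₁₄ + ϖE₂₂ + E₃₃ + E₄₁`,
the standard lattices `N₀, N₁` and their duals, and the standard self-dual
lattice sequences `Λ₁, …, Λ₅`. -/

variable (T : USetting F (Fin 4 → F))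

/-- the hermitian form of the non quasi-split unramified `U(4)`:
`h(v, w) = ᵗv̄ H w`, `H = E₁₄ + ϖE₂₂ + E₃₃ + E₄₁` -/
def IsU4Form : Prop :=
  ∀ v w : Fin 4 → F, T.h v w =
    T.conj (v 0) * w 3 + T.ϖ * (T.conj (v 1) * w 1) + T.conj (v 2) * w 2 +
      T.conj (v 3) * w 0

/-- `F/F₀` is quadratic unramified with common uniformizer `ϖ`:
`ϖ` is fixed by the involution, and `F = F₀[√ε]` for a non-square unit `ε` of `o₀`. -/
def IsUnramifiedQuadratic : Prop :=
  T.conj T.ϖ = T.ϖ ∧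
  ∃ ε s : F, ε ∈ T.O ∧ (∃ y ∈ T.O, ε * y = 1) ∧ T.conj ε = ε ∧
    (¬ ∃ y : F, T.conj y = y ∧ y ^ 2 = ε) ∧ s ^ 2 = ε ∧ T.conj s = -s

/-- `N₀ = o_F e₁ ⊕ o_F e₂ ⊕ o_F e₃ ⊕ o_F e₄` -/
def N0 : Set (Fin 4 → F) := {v | ∀ j, v j ∈ T.O}

/-- `N₁ = o_F e₁ ⊕ o_F e₂ ⊕ o_F e₃ ⊕ p_F e₄` -/
def N1 : Set (Fin 4 → F) := {v | (∀ j, v j ∈ T.O) ∧ v 3 ∈ T.pF}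

/-- `N₀^# = o_F e₁ ⊕ p_F⁻¹ e₂ ⊕ o_F e₃ ⊕ o_F e₄` -/
def N0s : Set (Fin 4 → F) :=
  {v | v 0 ∈ T.O ∧ T.ϖ * v 1 ∈ T.O ∧ v 2 ∈ T.O ∧ v 3 ∈ T.O}

/-- `N₁^# = p_F⁻¹ e₁ ⊕ p_F⁻¹ e₂ ⊕ o_F e₃ ⊕ o_F e₄` -/
def N1s : Set (Fin 4 → F) :=
  {v | T.ϖ * v 0 ∈ T.O ∧ T.ϖ * v 1 ∈ T.O ∧ v 2 ∈ T.O ∧ v 3 ∈ T.O}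

/-- `Λ₁(2i) = ϖ^i N₀`, `Λ₁(2i+1) = ϖ^{i+1} N₀^#` -/
def IsLam1 (Λ : T.LatSeq) : Prop :=
  Λ.e = 2 ∧ ∀ i : ℤ,
    Λ.L (2*i) = T.ϖ ^ i • T.N0 ∧ Λ.L (2*i+1) = T.ϖ ^ (i+1) • T.N0s

/-- `Λ₂(2i) = ϖ^i N₁`, `Λ₂(2i+1) = ϖ^{i+1} N₁^#` -/
def IsLam2 (Λ : T.LatSeq) : Prop :=
  Λ.e = 2 ∧ ∀ i : ℤ,
    Λ.L (2*i) = T.ϖ ^ i • T.N1 ∧ Λ.L (2*i+1) = T.ϖ ^ (i+1) • T.N1s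

/-- `Λ₃(4i) = ϖ^i N₀`, `Λ₃(4i+1) = ϖ^i N₁`, `Λ₃(4i+2) = ϖ^{i+1} N₁^#`,
`Λ₃(4i+3) = ϖ^{i+1} N₀^#` -/
def IsLam3 (Λ : T.LatSeq) : Prop :=
  Λ.e = 4 ∧ ∀ i : ℤ,
    Λ.L (4*i) = T.ϖ ^ i • T.N0 ∧ Λ.L (4*i+1) = T.ϖ ^ i • T.N1 ∧
    Λ.L (4*i+2) = T.ϖ ^ (i+1) • T.N1s ∧ Λ.L (4*i+3) = T.ϖ ^ (i+1) • T.N0s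

/-- `Λ₄(6i) = Λ₄(6i+1) = ϖ^i N₀`, `Λ₄(6i+2) = ϖ^i N₁`, `Λ₄(6i+3) = ϖ^{i+1} N₁^#`,
`Λ₄(6i+4) = Λ₄(6i+5) = ϖ^{i+1} N₀^#` -/
def IsLam4 (Λ : T.LatSeq) : Prop :=
  Λ.e = 6 ∧ ∀ i : ℤ,
    Λ.L (6*i) = T.ϖ ^ i • T.N0 ∧ Λ.L (6*i+1) = T.ϖ ^ i • T.N0 ∧
    Λ.L (6*i+2) = T.ϖ ^ i • T.N1 ∧ Λ.L (6*i+3) = T.ϖ ^ (i+1) • T.N1s ∧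
    Λ.L (6*i+4) = T.ϖ ^ (i+1) • T.N0s ∧ Λ.L (6*i+5) = T.ϖ ^ (i+1) • T.N0s

/-- `Λ₅(6i-1) = ϖ^i N₀`, `Λ₅(6i) = Λ₅(6i+1) = ϖ^i N₁`,
`Λ₅(6i+2) = Λ₅(6i+3) = ϖ^{i+1} N₁^#`, `Λ₅(6i+4) = ϖ^{i+1} N₀^#` -/
def IsLam5 (Λ : T.LatSeq) : Prop :=
  Λ.e = 6 ∧ ∀ i : ℤ,
    Λ.L (6*i-1) = T.ϖ ^ i • T.N0 ∧ Λ.L (6*i) = T.ϖ ^ i • T.N1 ∧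
    Λ.L (6*i+1) = T.ϖ ^ i • T.N1 ∧ Λ.L (6*i+2) = T.ϖ ^ (i+1) • T.N1s ∧
    Λ.L (6*i+3) = T.ϖ ^ (i+1) • T.N1s ∧ Λ.L (6*i+4) = T.ϖ ^ (i+1) • T.N0s

/-- the matrix of `β = ϖ^{-m}(Y E₂₃ - ϖ Ȳ E₃₂)` -/
def betaMat (m : ℤ) (Y : F) : Matrix (Fin 4) (Fin 4) F :=
  fun i j =>
    if i = 1 ∧ j = 2 then T.ϖ ^ (-m) * Y
    else if i = 2 ∧ j = 1 then -(T.ϖ ^ (1 - m) * T.conj Y) else 0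

/-- the matrix of `s₁ = E₁₄ + E₂₂ + E₃₃ + E₄₁` -/
def s1Mat : Matrix (Fin 4) (Fin 4) F :=
  !![0,0,0,1; 0,1,0,0; 0,0,1,0; 1,0,0,0]

/-- the matrix of `s₂ = ϖ⁻¹E₁₄ + E₂₂ + E₃₃ + ϖE₄₁` -/
def s2Mat : Matrix (Fin 4) (Fin 4) F :=
  !![0,0,0,T.ϖ⁻¹; 0,1,0,0; 0,0,1,0; T.ϖ,0,0,0]

end U4

end USetting


namespace U4Aux

variable {F : Type u} [Field F]

section pwsec
variable {V : Type v} [AddCommGroup V] [Module F V] (T : USetting F V)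

/-- `x ∈ ϖ^i R` -/
def pw (R : AddSubgroup F) (i : ℤ) (x : F) : Prop := ∃ r ∈ R, x = T.ϖ ^ i * r

/-- `o_F` as additive group -/
def OO : AddSubgroup F := T.O.toAddSubgroup

lemma mem_OO {x : F} : x ∈ OO T ↔ x ∈ T.O := Iff.rfl

/-- closure properties -/
structure RProp (R : AddSubgroup F) : Prop where
  sub : ∀ x ∈ R, x ∈ T.O
  mul : ∀ c ∈ T.O, ∀ r ∈ R, c * r ∈ R
  conj : ∀ r ∈ R, T.conj r ∈ R

lemma rprop_OO : RProp T (OO T) :=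
  ⟨fun _ h => h, fun _ hc _ hr => T.O.mul_mem hc hr, fun _ h => T.conj_O _ h⟩

lemma rprop_bot : RProp T ⊥ :=
  ⟨fun x h => by rw [AddSubgroup.mem_bot] at h; rw [h]; exact T.O.zero_mem,
   fun c _ r h => by rw [AddSubgroup.mem_bot] at *; rw [h, mul_zero],
   fun r h => by rw [AddSubgroup.mem_bot] at *; rw [h, map_zero]⟩

variable {T}
variable {R : AddSubgroup F}

lemma pw_zero (i : ℤ) : pw T R i 0 := ⟨0, R.zero_mem, by simp⟩
lemma pw_add {i : ℤ} {x y : F} (hx : pw T R i x) (hy : pw T R i y) : pw T R i (x + y) := by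
  obtain ⟨r, hr, rfl⟩ := hx
  obtain ⟨r', hr', rfl⟩ := hy
  exact ⟨r + r', R.add_mem hr hr', by ring⟩
lemma pw_neg {i : ℤ} {x : F} (hx : pw T R i x) : pw T R i (-x) := by
  obtain ⟨r, hr, rfl⟩ := hx
  exact ⟨-r, R.neg_mem hr, by ring⟩
lemma pw_sub {i : ℤ} {x y : F} (hx : pw T R i x) (hy : pw T R i y) : pw T R i (x - y) := by
  rw [sub_eq_add_neg]; exact pw_add hx (pw_neg hy)
lemma pw_mul (hR : RProp T R) {i j : ℤ} {x y : F} (hx : pw T R i x) (hy : pw T (OO T) j y) :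
    pw T R (i + j) (x * y) := by
  obtain ⟨r, hr, rfl⟩ := hx
  obtain ⟨r', hr', rfl⟩ := hy
  exact ⟨r' * r, hR.mul _ hr' _ hr, by rw [zpow_add₀ T.ϖ_ne_zero]; ring⟩
lemma pw_mulO (hR : RProp T R) {i : ℤ} {x y : F} (hx : pw T R i x) (hy : y ∈ T.O) :
    pw T R i (x * y) := by
  obtain ⟨r, hr, rfl⟩ := hx
  exact ⟨y * r, hR.mul _ hy _ hr, by ring⟩
lemma zpow_mem {k : ℤ} (hk : 0 ≤ k) : T.ϖ ^ k ∈ T.O := by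
  obtain ⟨n, rfl⟩ := Int.eq_ofNat_of_zero_le hk
  rw [zpow_natCast]; exact T.O.pow_mem T.ϖ_mem n
lemma pw_mono (hR : RProp T R) {i j : ℤ} (h : j ≤ i) {x : F} (hx : pw T R i x) : pw T R j x := by
  obtain ⟨r, hr, rfl⟩ := hx
  refine ⟨T.ϖ ^ (i - j) * r, hR.mul _ (zpow_mem (by omega)) _ hr, ?_⟩
  rw [← mul_assoc, ← zpow_add₀ T.ϖ_ne_zero]; congr 2; omega
lemma pw_shift {i j : ℤ} {x : F} : pw T R i (T.ϖ ^ j * x) ↔ pw T R (i - j) x := by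
  have h := T.ϖ_ne_zero
  constructor
  · rintro ⟨r, hr, e⟩
    refine ⟨r, hr, ?_⟩
    rw [zpow_sub₀ h]; field_simp; rw [← e, mul_comm]
  · rintro ⟨r, hr, rfl⟩
    refine ⟨r, hr, ?_⟩
    rw [zpow_sub₀ h]; field_simp
lemma pw_OO (hR : RProp T R) {i : ℤ} {x : F} (hx : pw T R i x) : pw T (OO T) i x := by
  obtain ⟨r, hr, rfl⟩ := hx
  exact ⟨r, hR.sub _ hr, rfl⟩
lemma pw_conj (hR : RProp T R) (hc : T.conj T.ϖ = T.ϖ) {i : ℤ} {x : F} (hx : pw T R i x) :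
    pw T R i (T.conj x) := by
  obtain ⟨r, hr, rfl⟩ := hx
  exact ⟨T.conj r, hR.conj _ hr, by rw [map_mul, map_zpow₀, hc]⟩
lemma pw_mem {i : ℤ} (hi : 0 ≤ i) {x : F} (hx : pw T (OO T) i x) : x ∈ T.O := by
  obtain ⟨r, hr, rfl⟩ := hx
  exact T.O.mul_mem (zpow_mem hi) hr
lemma pw_bot {i : ℤ} {x : F} : pw T ⊥ i x ↔ x = 0 := by
  constructor
  · rintro ⟨r, hr, rfl⟩
    rw [AddSubgroup.mem_bot] at hr; rw [hr, mul_zero]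
  · rintro rfl; exact pw_zero i

/-- the fixed integers -/
def R0 (T : USetting F V) : AddSubgroup F where
  carrier := {x | x ∈ T.O ∧ T.conj x = x}
  zero_mem' := ⟨T.O.zero_mem, map_zero _⟩
  add_mem' := fun ha hb => ⟨T.O.add_mem ha.1 hb.1, by rw [map_add, ha.2, hb.2]⟩
  neg_mem' := fun ha => ⟨T.O.neg_mem ha.1, by rw [map_neg, ha.2]⟩

/-- transversal of `ϖ^t R` in `R` -/
def Trans (T : USetting F V) (R : AddSubgroup F) (t : ℤ) {ι : Type w} (f : ι → F) : Prop :=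
  (∀ i, f i ∈ R) ∧ (∀ x ∈ R, ∃ i, pw T R t (x - f i)) ∧ ∀ i j, pw T R t (f i - f j) → i = j

lemma trans_pow (hϖ : ∀ r ∈ R, T.ϖ * r ∈ R) {ι : Type w} {f : ι → F} (hf : Trans T R 1 f) (t : ℕ) :
    ∃ (ι' : Type w) (f' : ι' → F), Trans T R t f' ∧ Nat.card ι' = Nat.card ι ^ t := by
  have h0 := T.ϖ_ne_zero
  have hϖt : ∀ t : ℕ, ∀ r ∈ R, T.ϖ ^ t * r ∈ R := by
    intro t; induction t with
    | zero => intro r hr; simpa using hr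
    | succ t ih => intro r hr; rw [pow_succ, mul_assoc]; exact ih _ (hϖ _ hr)
  induction t with
  | zero =>
    refine ⟨PUnit, fun _ => 0, ⟨fun _ => R.zero_mem, fun x hx => ⟨PUnit.unit, x, hx, by simp⟩,
      fun _ _ _ => rfl⟩, by simp⟩
  | succ t ih =>
    obtain ⟨ι', f', ⟨h1, h2, h3⟩, hc⟩ := ih
    refine ⟨ι' × ι, fun p => f' p.1 + T.ϖ ^ t * f p.2, ⟨?_, ?_, ?_⟩, ?_⟩
    · intro p; exact R.add_mem (h1 _) (hϖt _ _ (hf.1 _))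
    · intro x hx
      obtain ⟨i, r, hr, e⟩ := h2 x hx
      obtain ⟨j, r', hr', e'⟩ := hf.2.1 r hr
      refine ⟨(i, j), r', hr', ?_⟩
      have e2 : r = f j + T.ϖ * r' := by rw [zpow_one] at e'; rw [← e']; ring
      rw [e2] at e
      have : ((t + 1 : ℕ) : ℤ) = (t : ℤ) + 1 := by push_cast; ring
      rw [this, zpow_add₀ h0, zpow_one]
      rw [zpow_natCast] at *
      linear_combination e
    · rintro ⟨i, j⟩ ⟨i', j'⟩ ⟨r, hr, e⟩
      simp only at e
      have : ((t + 1 : ℕ) : ℤ) = (t : ℤ) + 1 := by push_cast; ring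
      rw [this, zpow_add₀ h0, zpow_one] at e
      have hi : i = i' := by
        apply h3
        refine ⟨T.ϖ * r + f j' - f j, R.sub_mem (R.add_mem (hϖ _ hr) (hf.1 _)) (hf.1 _), ?_⟩
        rw [zpow_natCast] at *
        linear_combination e
      subst hi
      have hj : j = j' := by
        apply hf.2.2
        refine ⟨r, hr, ?_⟩
        have hp : T.ϖ ^ t ≠ 0 := pow_ne_zero _ h0
        apply mul_left_cancel₀ hp
        rw [zpow_natCast] at *
        rw [zpow_one]
        linear_combination e
      rw [hj]
    · rw [Nat.card_prod, hc, pow_succ]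

lemma two_unit (hodd : ¬ (2 ∣ T.residueChar)) : ∃ y ∈ T.O, (2 : F) * y = 1 := by
  by_contra hcon
  push Not at hcon
  have h2 : (2 : F) ∈ T.O := by
    have : (2 : F) = 1 + 1 := by norm_num
    rw [this]; exact T.O.add_mem T.O.one_mem T.O.one_mem
  obtain ⟨z, hz, e⟩ := T.unif 2 h2 hcon
  set I : Ideal T.O := Ideal.span {(⟨T.ϖ, T.ϖ_mem⟩ : T.O)} with hI
  have hd : ringChar (T.O ⧸ I) ∣ 2 := by
    apply ringChar.dvd
    have : ((2 : ℕ) : T.O ⧸ I) = Ideal.Quotient.mk I ((2 : ℕ) : T.O) := (map_natCast _ 2).symm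
    rw [this, Ideal.Quotient.eq_zero_iff_mem, hI, Ideal.mem_span_singleton]
    exact ⟨⟨z, hz⟩, Subtype.ext (by push_cast; exact e)⟩
  have hr : T.residueChar = ringChar (T.O ⧸ I) := rfl
  rw [hr] at hodd
  rcases (Nat.dvd_prime Nat.prime_two).1 hd with h | h
  · have h1 : ((1 : ℕ) : T.O ⧸ I) = 0 := by
      rw [← h]; exact ringChar.Nat.cast_ringChar
    have : ((1 : ℕ) : T.O ⧸ I) = Ideal.Quotient.mk I (1 : T.O) := by simp
    rw [this, Ideal.Quotient.eq_zero_iff_mem, hI, Ideal.mem_span_singleton] at h1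
    obtain ⟨c, hc⟩ := h1
    exact T.ϖ_not_unit c c.2 (by simpa using (congrArg Subtype.val hc).symm)
  · rw [h] at hodd; exact hodd (dvd_refl 2)

/-- basic unramified data -/
structure UData (T : USetting F V) (s i2 si : F) : Prop where
  cϖ : T.conj T.ϖ = T.ϖ
  i2O : i2 ∈ T.O
  h2 : 2 * i2 = 1
  sO : s ∈ T.O
  siO : si ∈ T.O
  hs : s * si = 1
  cs : T.conj s = -s
  ci2 : T.conj i2 = i2
  csi : T.conj si = -si

lemma exists_udata (hodd : ¬ (2 ∣ T.residueChar)) (hc : T.conj T.ϖ = T.ϖ)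
    (h : ∃ ε s : F, ε ∈ T.O ∧ (∃ y ∈ T.O, ε * y = 1) ∧ T.conj ε = ε ∧
    (¬ ∃ y : F, T.conj y = y ∧ y ^ 2 = ε) ∧ s ^ 2 = ε ∧ T.conj s = -s) :
    ∃ s i2 si, UData T s i2 si := by
  obtain ⟨i2, hi2, h2⟩ := two_unit hodd
  obtain ⟨ε, s, hε, ⟨y, hy, hεy⟩, -, -, hs2, hcs⟩ := h
  have hs0 : s ≠ 0 := by
    rintro rfl
    rw [← hs2] at hεy; simp at hεy
  have hsO : s ∈ T.O := by
    rcases T.O_val s hs0 with h | h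
    · exact h
    · have : s = ε * s⁻¹ := by rw [← hs2]; field_simp
      rw [this]; exact T.O.mul_mem hε h
  have hss : s * (s * y) = 1 := by rw [← hεy, ← hs2]; ring
  refine ⟨s, i2, s * y, hc, hi2, h2, hsO, T.O.mul_mem hsO hy, hss, hcs, ?_, ?_⟩
  · have := congrArg T.conj h2
    rw [map_mul, map_one, map_ofNat] at this
    linear_combination i2 * this - T.conj i2 * h2
  · have := congrArg T.conj hss
    rw [map_mul, map_one, hcs] at this
    linear_combination (-(s*y)) * this - T.conj (s*y) * hss

lemma UData.mul_R0 {x y : F} (hx : x ∈ R0 T) (hy : y ∈ R0 T) : x * y ∈ R0 T :=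
  ⟨T.O.mul_mem hx.1 hy.1, by rw [map_mul, hx.2, hy.2]⟩

lemma UData.re {s i2 si : F} (hU : UData T s i2 si) {x : F} (hx : x ∈ T.O) :
    i2 * (x + T.conj x) ∈ R0 T :=
  ⟨T.O.mul_mem hU.i2O (T.O.add_mem hx (T.conj_O _ hx)), by
    rw [map_mul, map_add, T.conj_invol, hU.ci2]; ring⟩
lemma UData.im {s i2 si : F} (hU : UData T s i2 si) {x : F} (hx : x ∈ T.O) :
    si * (i2 * (x - T.conj x)) ∈ R0 T :=
  ⟨T.O.mul_mem hU.siO (T.O.mul_mem hU.i2O (T.O.sub_mem hx (T.conj_O _ hx))), by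
    rw [map_mul, map_mul, map_sub, T.conj_invol, hU.ci2, hU.csi]; ring⟩
lemma UData.dec {s i2 si : F} (hU : UData T s i2 si) (x : F) :
    x = i2 * (x + T.conj x) + s * (si * (i2 * (x - T.conj x))) := by
  linear_combination (-x) * hU.h2 - i2 * (x - T.conj x) * hU.hs
lemma UData.uniq {s i2 si : F} (hU : UData T s i2 si) {a b : F} (ha : T.conj a = a)
    (hb : T.conj b = b) :
    i2 * ((a + s * b) + T.conj (a + s * b)) = a ∧
    si * (i2 * ((a + s * b) - T.conj (a + s * b))) = b := by
  rw [map_add, map_mul, ha, hb, hU.cs]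
  constructor
  · linear_combination a * hU.h2
  · linear_combination b * hU.h2 + 2 * i2 * b * hU.hs

lemma trans_OO {s i2 si : F} (hU : UData T s i2 si) {t : ℤ} {ι : Type w} {f : ι → F}
    (hf : Trans T (R0 T) t f) :
    Trans T (OO T) t (fun p : ι × ι => f p.1 + s * f p.2) := by
  refine ⟨?_, ?_, ?_⟩
  · intro p; exact T.O.add_mem (hf.1 _).1 (T.O.mul_mem hU.sO (hf.1 _).1)
  · intro x hx
    obtain ⟨i, r, hr, e⟩ := hf.2.1 _ (hU.re hx)
    obtain ⟨j, r', hr', e'⟩ := hf.2.1 _ (hU.im hx)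
    refine ⟨(i, j), r + s * r', T.O.add_mem hr.1 (T.O.mul_mem hU.sO hr'.1), ?_⟩
    linear_combination hU.dec x + e + s * e'
  · rintro ⟨i, j⟩ ⟨i', j'⟩ ⟨r, hr, e⟩
    have e1 : f i + s * f j - (f i' + s * f j') = (f i - f i') + s * (f j - f j') := by ring
    simp only at e
    rw [e1] at e
    have ca : T.conj (f i - f i') = f i - f i' := by
      rw [map_sub, (hf.1 _).2, (hf.1 _).2]
    have cb : T.conj (f j - f j') = f j - f j' := by
      rw [map_sub, (hf.1 _).2, (hf.1 _).2]
    obtain ⟨u1, u2⟩ := hU.uniq ca cb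
    have ct : T.conj (T.ϖ ^ t) = T.ϖ ^ t := by rw [map_zpow₀, hU.cϖ]
    rw [e, map_mul, ct] at u1 u2
    have hi := hf.2.2 i i' ⟨_, hU.re hr, by rw [← u1]; ring⟩
    have hj := hf.2.2 j j' ⟨_, hU.im hr, by rw [← u2]; ring⟩
    rw [hi, hj]

lemma trans_base (F₀ : Type w) [Field F₀] [Algebra F₀ F] 
    (hfix : ∀ x : F, T.conj x = x ↔ x ∈ (algebraMap F₀ F).range)
    (ϖ₀ : F₀) (hϖ₀ : algebraMap F₀ F ϖ₀ = T.ϖ)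
    (hϖ₀mem : ϖ₀ ∈ T.O.comap (algebraMap F₀ F)) :
    ∃ f : ((T.O.comap (algebraMap F₀ F)) ⧸
        (Ideal.span {(⟨ϖ₀, hϖ₀mem⟩ : T.O.comap (algebraMap F₀ F))} :
          Ideal (T.O.comap (algebraMap F₀ F)))) → F, Trans T (R0 T) 1 f := by
  set I := (Ideal.span {(⟨ϖ₀, hϖ₀mem⟩ : T.O.comap (algebraMap F₀ F))} :
          Ideal (T.O.comap (algebraMap F₀ F))) with hI
  have key : ∀ x : T.O.comap (algebraMap F₀ F),
      pw T (R0 T) 1 (algebraMap F₀ F x) ↔ x ∈ I := by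
    intro x
    rw [hI, Ideal.mem_span_singleton]
    constructor
    · rintro ⟨r, hr, e⟩
      obtain ⟨r0, rfl⟩ := (hfix r).1 hr.2
      refine ⟨⟨r0, hr.1⟩, Subtype.ext ?_⟩
      apply (algebraMap F₀ F).injective
      rw [e]; simp [hϖ₀]
    · rintro ⟨c, rfl⟩
      refine ⟨algebraMap F₀ F c, ⟨c.2, (hfix _).2 ⟨_, rfl⟩⟩, ?_⟩
      simp [hϖ₀]
  have hsurj := Ideal.Quotient.mk_surjective (I := I)
  choose g hg using hsurj
  refine ⟨fun i => algebraMap F₀ F (g i), ?_, ?_, ?_⟩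
  · intro i; exact ⟨(g i).2, (hfix _).2 ⟨_, rfl⟩⟩
  · intro x hx
    obtain ⟨x0, rfl⟩ := (hfix x).1 hx.2
    refine ⟨Ideal.Quotient.mk I ⟨x0, hx.1⟩, ?_⟩
    have := (key (⟨x0, hx.1⟩ - g (Ideal.Quotient.mk I ⟨x0, hx.1⟩))).2 (by
      rw [← Ideal.Quotient.eq, hg])
    simpa using this
  · intro i j h
    have := (key (g i - g j)).1 (by simpa using h)
    rw [← Ideal.Quotient.eq, hg, hg] at this
    exact this

end pwsec


section matsec
variable (T : USetting F (Fin 4 → F))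

/-- matrix of an element of `G` -/
def mat (k : T.GU) : Matrix (Fin 4) (Fin 4) F := LinearMap.toMatrix' (T.toE k)

variable {T}

lemma toE_eq (k : T.GU) : T.toE k = Matrix.toLin' (mat T k) := by
  rw [mat, Matrix.toLin'_toMatrix']

lemma mat_mul (k l : T.GU) : mat T (k * l) = mat T k * mat T l := by
  unfold mat
  rw [← LinearMap.toMatrix'_mul]; rfl

lemma mat_one : mat T 1 = 1 := by
  unfold mat
  exact LinearMap.toMatrix'_one

lemma mat_inj {k l : T.GU} (h : mat T k = mat T l) : k = l := by
  apply Subtype.ext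
  apply Units.ext
  exact LinearMap.toMatrix'.injective h

lemma mat_inv_mul (k : T.GU) : mat T k⁻¹ * mat T k = 1 := by
  rw [← mat_mul, inv_mul_cancel, mat_one]
lemma mat_mul_inv (k : T.GU) : mat T k * mat T k⁻¹ = 1 := by
  rw [← mat_mul, mul_inv_cancel, mat_one]

lemma mat_of_toE {k : T.GU} {M : Matrix (Fin 4) (Fin 4) F} (h : T.toE k = Matrix.toLin' M) :
    mat T k = M := by
  rw [mat, h, LinearMap.toMatrix'_toLin']

lemma unit_adj (k : T.GU) (v w : Fin 4 → F) :
    T.h ((mat T k).mulVec v) w = T.h v ((mat T k⁻¹).mulVec w) := by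
  have h1 : (mat T k).mulVec v = T.toE k v := by rw [toE_eq, Matrix.toLin'_apply]
  have h2 : (mat T k⁻¹).mulVec w = T.toE k⁻¹ w := by rw [toE_eq, Matrix.toLin'_apply]
  rw [h1, h2, T.σA_adj]
  congr 1
  have := k.2
  change T.σA (T.toE k) = _ at this
  rw [this]; rfl

lemma inv_col (hform : T.IsU4Form) (k : T.GU) :
    mat T k⁻¹ 0 3 = T.conj (mat T k 0 3) ∧ T.ϖ * mat T k⁻¹ 1 3 = T.conj (mat T k 0 1) ∧
    mat T k⁻¹ 2 3 = T.conj (mat T k 0 2) ∧ mat T k⁻¹ 3 3 = T.conj (mat T k 0 0) := by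
  have key := fun j => unit_adj k (Pi.single j 1) (Pi.single 3 1)
  simp only [hform _ _, Matrix.mulVec_single_one] at key
  have k0 := key 0
  have k1 := key 1
  have k2 := key 2
  have k3 := key 3
  simp at k0 k1 k2 k3
  exact ⟨k3.symm, k1.symm, k2.symm, k0.symm⟩

lemma row_rel (hform : T.IsU4Form) (k : T.GU) (i : Fin 4) (hi : i ≠ 3) :
    mat T k i 0 * T.conj (mat T k 0 3) + mat T k i 1 * (T.ϖ⁻¹ * T.conj (mat T k 0 1)) +
    mat T k i 2 * T.conj (mat T k 0 2) + mat T k i 3 * T.conj (mat T k 0 0) = 0 := by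
  obtain ⟨h0, h1, h2, h3⟩ := inv_col hform k
  have := congrFun (congrFun (mat_mul_inv k) i) 3
  rw [Matrix.mul_apply, Fin.sum_univ_four, Matrix.one_apply_ne hi] at this
  rw [← h0, ← h1, ← h2, ← h3, ← mul_assoc T.ϖ⁻¹, inv_mul_cancel₀ T.ϖ_ne_zero, one_mul]
  exact this

lemma h_nondeg_right {x y : Fin 4 → F} (h : ∀ v, T.h v x = T.h v y) : x = y := by
  have : x - y = 0 := by
    apply T.h_nondeg
    intro w
    have e : ∀ z, T.h z w = T.conj (T.h w z) := fun z => T.h_conj_symm _ _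
    have hs : T.h (x - y) w = T.h x w - T.h y w := by
      have := T.h_add_left (x - y) y w
      rw [sub_add_cancel] at this
      rw [this]; ring
    rw [hs, e x, e y, h w, sub_self]
  exact sub_eq_zero.1 this

lemma exists_mat {M N : Matrix (Fin 4) (Fin 4) F} (h1 : M * N = 1)
    (hadj : ∀ v w, T.h (M.mulVec v) w = T.h v (N.mulVec w)) : ∃ k : T.GU, mat T k = M := by
  have h2 : N * M = 1 := mul_eq_one_comm.1 h1
  let U : (Module.End F (Fin 4 → F))ˣ :=
    ⟨Matrix.toLin' M, Matrix.toLin' N, by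
      rw [Module.End.mul_eq_comp, ← Matrix.toLin'_mul, h1, Matrix.toLin'_one]; rfl, by
      rw [Module.End.mul_eq_comp, ← Matrix.toLin'_mul, h2, Matrix.toLin'_one]; rfl⟩
  refine ⟨⟨U, ?_⟩, ?_⟩
  · change T.σA (Matrix.toLin' M) = Matrix.toLin' N
    apply LinearMap.ext
    intro w
    apply h_nondeg_right (T := T)
    intro v
    rw [← T.σA_adj, Matrix.toLin'_apply, Matrix.toLin'_apply, hadj]
  · apply mat_of_toE; rfl

/-- Heisenberg matrices -/
def uM (T : USetting F (Fin 4 → F)) (x y z : F) : Matrix (Fin 4) (Fin 4) F :=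
  !![1, x, y, z; 0, 1, 0, -(T.ϖ⁻¹ * T.conj x); 0, 0, 1, -T.conj y; 0, 0, 0, 1]

/-- the constraint -/
def uC (T : USetting F (Fin 4 → F)) (x y z : F) : Prop :=
  z + T.conj z + T.ϖ⁻¹ * (x * T.conj x) + y * T.conj y = 0

lemma uM_mul (x y z x' y' z' : F) : uM T x y z * uM T x' y' z' =
    uM T (x + x') (y + y') (z + z' - T.ϖ⁻¹ * (x * T.conj x') - y * T.conj y') := by
  unfold uM
  ext i j
  fin_cases i <;> fin_cases j <;> simp [Matrix.mul_apply, Fin.sum_univ_four] <;> ring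

lemma uM_zero : uM T 0 0 0 = 1 := by
  unfold uM
  ext i j
  fin_cases i <;> fin_cases j <;> simp

lemma exists_u (hform : T.IsU4Form) (hc : T.conj T.ϖ = T.ϖ) {x y z : F} (h : uC T x y z) :
    ∃ k : T.GU, mat T k = uM T x y z := by
  unfold uC at h
  have h0 := T.ϖ_ne_zero
  apply exists_mat (N := uM T (-x) (-y) (T.conj z))
  · rw [uM_mul, ← uM_zero]
    congr 1
    · ring
    · ring
    · rw [map_neg, map_neg]; linear_combination h
  · intro v w
    rw [hform, hform]
    simp [uM, Matrix.mulVec, dotProduct, Fin.sum_univ_four, T.conj_invol, hc]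
    field_simp
    ring

/-- elements of the Heisenberg group -/
def uE (T : USetting F (Fin 4 → F)) (x y z : F) : T.GU :=
  if h : ∃ k : T.GU, mat T k = uM T x y z then h.choose else 1

lemma mat_uE (hform : T.IsU4Form) (hc : T.conj T.ϖ = T.ϖ) {x y z : F} (h : uC T x y z) :
    mat T (uE T x y z) = uM T x y z := by
  unfold uE
  rw [dif_pos (exists_u hform hc h)]
  exact (exists_u hform hc h).choose_spec

lemma uC_inv {x y z : F} (h : uC T x y z) : uC T (-x) (-y) (T.conj z) := by
  unfold uC at *
  rw [T.conj_invol, map_neg, map_neg]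
  linear_combination h

lemma uE_inv (hform : T.IsU4Form) (hc : T.conj T.ϖ = T.ϖ) {x y z : F} (h : uC T x y z) :
    (uE T x y z)⁻¹ = uE T (-x) (-y) (T.conj z) := by
  symm
  apply eq_inv_of_mul_eq_one_right
  apply mat_inj
  rw [mat_mul, mat_uE hform hc h, mat_uE hform hc (uC_inv h), uM_mul, mat_one, ← uM_zero]
  unfold uC at h
  congr 1
  · ring
  · ring
  · rw [map_neg, map_neg]; linear_combination h

/-- the middle block -/
def blk (X : Matrix (Fin 4) (Fin 4) F) : Matrix (Fin 4) (Fin 4) F :=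
  !![0, 0, 0, 0; 0, X 1 1, X 1 2, 0; 0, X 2 1, X 2 2, 0; 0, 0, 0, 0]

/-- entrywise conditions -/
structure QQ (T : USetting F (Fin 4 → F)) (R : AddSubgroup F) (m a b : ℤ)
    (X : Matrix (Fin 4) (Fin 4) F) : Prop where
  h00 : pw T (OO T) m (X 0 0)
  h03 : pw T (OO T) m (X 0 3)
  h30 : pw T (OO T) m (X 3 0)
  h33 : pw T (OO T) m (X 3 3)
  h01 : pw T R a (X 0 1)
  h31 : pw T R a (X 3 1)
  h02 : pw T R b (X 0 2)
  h32 : pw T R b (X 3 2)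
  h10 : pw T R (a - 1) (X 1 0)
  h13 : pw T R (a - 1) (X 1 3)
  h20 : pw T R b (X 2 0)
  h23 : pw T R b (X 2 3)

/-- context of the main computation -/
structure Ctx (T : USetting F (Fin 4 → F)) (R : AddSubgroup F) (m a b : ℤ)
    (S : Set (Matrix (Fin 4) (Fin 4) F)) (K : Subgroup T.GU) : Prop where
  hform : T.IsU4Form
  hc : T.conj T.ϖ = T.ϖ
  hR : RProp T R
  hm : 1 ≤ m
  ha : 0 ≤ a
  hb : 0 ≤ b
  ha2 : m ≤ 2 * a - 1
  hb2 : m ≤ 2 * b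
  hS : ∀ X, X ∈ S ↔ QQ T R m a b X ∧ blk X ∈ S
  h0 : (0 : Matrix (Fin 4) (Fin 4) F) ∈ S
  hK : ∀ k, k ∈ K ↔ mat T k - 1 ∈ S

variable {R : AddSubgroup F} {m a b : ℤ} {S : Set (Matrix (Fin 4) (Fin 4) F)} {K : Subgroup T.GU}

lemma Ctx.uE_mem (C : Ctx T R m a b S K) {x y z : F} (h : uC T x y z) :
    uE T x y z ∈ K ↔ pw T R a x ∧ pw T R b y ∧ pw T (OO T) m z := by
  rw [C.hK, mat_uE C.hform C.hc h, C.hS]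
  constructor
  · rintro ⟨q, -⟩
    refine ⟨?_, ?_, ?_⟩
    · simpa [uM] using q.h01
    · simpa [uM] using q.h02
    · simpa [uM] using q.h03
  · rintro ⟨hx, hy, hz⟩
    refine ⟨⟨?_, ?_, ?_, ?_, ?_, ?_, ?_, ?_, ?_, ?_, ?_, ?_⟩, ?_⟩
    · simpa [uM] using pw_zero m
    · simpa [uM] using hz
    · simpa [uM] using pw_zero m
    · simpa [uM] using pw_zero m
    · simpa [uM] using hx
    · simpa [uM] using pw_zero a
    · simpa [uM] using hy
    · simpa [uM] using pw_zero b
    · simpa [uM] using pw_zero (a - 1)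
    · have : pw T R (a - 1) (-(T.ϖ ^ (-1 : ℤ) * T.conj x)) := by
        apply pw_neg
        rw [pw_shift]
        exact pw_mono C.hR (by omega) (pw_conj C.hR C.hc hx)
      simpa [uM] using this
    · simpa [uM] using pw_zero b
    · have := pw_neg (pw_conj C.hR C.hc hy)
      simpa [uM] using this
    · have : blk (uM T x y z - 1) = 0 := by
        ext i j
        fin_cases i <;> fin_cases j <;> simp [blk, uM]
      rw [this]; exact C.h0

/-- the diagonal element -/
def dM (T : USetting F (Fin 4 → F)) (t : ℤ) : Matrix (Fin 4) (Fin 4) F :=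
  !![T.ϖ ^ t, 0, 0, 0; 0, 1, 0, 0; 0, 0, 1, 0; 0, 0, 0, T.ϖ ^ (-t)]

lemma dM_mul (t t' : ℤ) : dM T t * dM T t' = dM T (t + t') := by
  have h0 := T.ϖ_ne_zero
  unfold dM
  ext i j
  fin_cases i <;> fin_cases j <;> simp [Matrix.mul_apply, Fin.sum_univ_four, zpow_add₀ h0]
  ring

lemma dM_zero : dM T 0 = 1 := by
  unfold dM
  ext i j
  fin_cases i <;> fin_cases j <;> simp

lemma mat_inv_of {g : T.GU} {M N : Matrix (Fin 4) (Fin 4) F} (hg : mat T g = M) (h : M * N = 1) :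
    mat T g⁻¹ = N := by
  have h1 := mat_inv_mul g
  rw [hg] at h1
  calc mat T g⁻¹ = mat T g⁻¹ * (M * N) := by rw [h, mul_one]
    _ = N := by rw [← mul_assoc, h1, one_mul]

lemma mat_d_inv {g : T.GU} {t : ℤ} (hg : mat T g = dM T t) : mat T g⁻¹ = dM T (-t) :=
  mat_inv_of hg (by rw [dM_mul, add_neg_cancel, dM_zero])

lemma uC_scale (hc : T.conj T.ϖ = T.ϖ) {x y z : F} (h : uC T x y z) (t : ℤ) :
    uC T (T.ϖ ^ (-t) * x) (T.ϖ ^ (-t) * y) (T.ϖ ^ (-(2 * t)) * z) := by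
  unfold uC at *
  have h0 := T.ϖ_ne_zero
  have e : T.ϖ ^ (-(2 * t)) = T.ϖ ^ (-t) * T.ϖ ^ (-t) := by
    rw [← zpow_add₀ h0]; congr 1; ring
  rw [e]
  simp only [map_mul, map_zpow₀, hc]
  linear_combination (T.ϖ ^ (-t) * T.ϖ ^ (-t)) * h

lemma conj_uE (hform : T.IsU4Form) (hc : T.conj T.ϖ = T.ϖ) {g : T.GU} {t : ℤ}
    (hg : mat T g = dM T t) {x y z : F} (h : uC T x y z) :
    g⁻¹ * uE T x y z * g = uE T (T.ϖ ^ (-t) * x) (T.ϖ ^ (-t) * y) (T.ϖ ^ (-(2 * t)) * z) := by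
  have h0 := T.ϖ_ne_zero
  have e : T.ϖ ^ (-(2 * t)) = T.ϖ ^ (-t) * T.ϖ ^ (-t) := by
    rw [← zpow_add₀ h0]; congr 1; ring
  apply mat_inj
  rw [mat_mul, mat_mul, mat_d_inv hg, hg, mat_uE hform hc h, mat_uE hform hc (uC_scale hc h t), e]
  unfold dM uM
  ext i j
  fin_cases i <;> fin_cases j <;>
    simp [Matrix.mul_apply, Fin.sum_univ_four, zpow_neg, map_mul, map_zpow₀, hc] <;> field_simp

lemma unit_of {x : F} (hm : 1 ≤ m) (hx : pw T (OO T) m (x - 1)) : x ≠ 0 ∧ x⁻¹ ∈ T.O := by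
  have hx1 := pw_mono (rprop_OO T) hm hx
  obtain ⟨r, hr, e⟩ := hx1
  rw [zpow_one] at e
  have hxO : x ∈ T.O := by
    have : x = 1 + T.ϖ * r := by rw [← e]; ring
    rw [this]; exact T.O.add_mem T.O.one_mem (T.O.mul_mem T.ϖ_mem hr)
  by_cases hu : ∃ y ∈ T.O, x * y = 1
  · obtain ⟨y, hy, hxy⟩ := hu
    refine ⟨left_ne_zero_of_mul_eq_one hxy, ?_⟩
    rw [← eq_inv_of_mul_eq_one_right hxy]; exact hy
  · push Not at hu
    obtain ⟨z, hz, e'⟩ := T.unif x hxO hu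
    exfalso
    apply T.ϖ_not_unit (z - r) (T.O.sub_mem hz hr)
    rw [mul_sub, ← e, ← e']; ring

lemma Ctx.factor (C : Ctx T R m a b S K) {g : T.GU} {t : ℕ} (hg : mat T g = dM T t) {k : T.GU}
    (hk : k ∈ K) : ∃ x y z, uC T x y z ∧ uE T x y z ∈ K ∧ g⁻¹ * ((uE T x y z)⁻¹ * k) * g ∈ K := by
  have h0 := T.ϖ_ne_zero
  have hl : k⁻¹ ∈ K := K.inv_mem hk
  set l := k⁻¹ with hldef
  have ql := ((C.hS _).1 ((C.hK l).1 hl)).1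
  have q00 : pw T (OO T) m (mat T l 0 0 - 1) := by simpa using ql.h00
  have q01 : pw T R a (mat T l 0 1) := by simpa using ql.h01
  have q02 : pw T R b (mat T l 0 2) := by simpa using ql.h02
  have q03 : pw T (OO T) m (mat T l 0 3) := by simpa using ql.h03
  obtain ⟨hne, hinv⟩ := unit_of C.hm q00
  have hcne : T.conj (mat T l 0 0) ≠ 0 := by simpa using hne
  set c := (mat T l 0 0)⁻¹ with hcdef
  have hr := row_rel C.hform l 0 (by decide)
  have hu : uC T (mat T l 0 1 * c) (mat T l 0 2 * c) (mat T l 0 3 * c) := by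
    unfold uC
    simp only [map_mul, hcdef, map_inv₀]
    field_simp
    field_simp at hr
    linear_combination hr
  have huK : uE T (mat T l 0 1 * c) (mat T l 0 2 * c) (mat T l 0 3 * c) ∈ K := by
    rw [C.uE_mem hu]
    exact ⟨pw_mulO C.hR q01 hinv, pw_mulO C.hR q02 hinv, pw_mulO (rprop_OO T) q03 hinv⟩
  set u0 := uE T (mat T l 0 1 * c) (mat T l 0 2 * c) (mat T l 0 3 * c) with hu0
  have hu0i := uE_inv C.hform C.hc hu
  refine ⟨_, _, _, uC_inv hu, ?_, ?_⟩
  · rw [← hu0i]; exact K.inv_mem huK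
  rw [← hu0i, ← hu0]
  have hh : l * u0⁻¹ ∈ K := K.mul_mem hl (K.inv_mem huK)
  set h := l * u0⁻¹ with hhdef
  have e1 : g⁻¹ * ((u0⁻¹)⁻¹ * k) * g = (g⁻¹ * h * g)⁻¹ := by
    rw [hhdef, hldef]; group
  rw [e1]
  apply K.inv_mem
  have hhu : mat T h * uM T (mat T l 0 1 * c) (mat T l 0 2 * c) (mat T l 0 3 * c) = mat T l := by
    rw [← mat_uE C.hform C.hc hu, ← hu0, ← mat_mul, hhdef, inv_mul_cancel_right]
  have r0 := congrFun (congrFun hhu 0) 0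
  have r1 := congrFun (congrFun hhu 0) 1
  have r2 := congrFun (congrFun hhu 0) 2
  have r3 := congrFun (congrFun hhu 0) 3
  simp [Matrix.mul_apply, Fin.sum_univ_four, uM] at r0 r1 r2 r3
  have hc1 : mat T l 0 0 * c = 1 := mul_inv_cancel₀ hne
  have s1 : mat T h 0 1 = 0 := by
    rw [r0] at r1; linear_combination r1 - mat T l 0 1 * hc1
  have s2 : mat T h 0 2 = 0 := by
    rw [r0] at r2; linear_combination r2 - mat T l 0 2 * hc1
  have s3 : mat T h 0 3 = 0 := by
    rw [r0, s1, s2] at r3; linear_combination r3 - mat T l 0 3 * hc1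
  have s13 : mat T h 1 3 = 0 := by
    have := row_rel C.hform h 1 (by decide)
    rw [s1, s2, s3, r0] at this
    simpa [hne] using this
  have s23 : mat T h 2 3 = 0 := by
    have := row_rel C.hform h 2 (by decide)
    rw [s1, s2, s3, r0] at this
    simpa [hne] using this
  have qh := (C.hS _).1 ((C.hK h).1 hh)
  have hgh : mat T (g⁻¹ * h * g) = !![mat T h 0 0, 0, 0, 0;
      T.ϖ ^ (t : ℤ) * mat T h 1 0, mat T h 1 1, mat T h 1 2, 0;
      T.ϖ ^ (t : ℤ) * mat T h 2 0, mat T h 2 1, mat T h 2 2, 0;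
      T.ϖ ^ (t : ℤ) * (T.ϖ ^ (t : ℤ) * mat T h 3 0), T.ϖ ^ (t : ℤ) * mat T h 3 1,
      T.ϖ ^ (t : ℤ) * mat T h 3 2, mat T h 3 3] := by
    rw [mat_mul, mat_mul, mat_d_inv hg, hg]
    unfold dM
    ext i j
    fin_cases i <;> fin_cases j <;>
      simp [Matrix.mul_apply, Matrix.vecMul, dotProduct, Fin.sum_univ_four, s1, s2, s3, s13, s23] <;> try field_simp
  rw [C.hK, hgh, C.hS]
  have sc : ∀ {R : AddSubgroup F} {i : ℤ} {x : F}, RProp T R → pw T R i x →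
      pw T R i (T.ϖ ^ (t : ℤ) * x) := fun hR hx => pw_shift.2 (pw_mono hR (by omega) hx)
  obtain ⟨q, qb⟩ := qh
  refine ⟨⟨?_, ?_, ?_, ?_, ?_, ?_, ?_, ?_, ?_, ?_, ?_, ?_⟩, ?_⟩
  · simpa using q.h00
  · simpa using pw_zero m
  · simpa using sc (rprop_OO T) (sc (rprop_OO T) q.h30)
  · simpa using q.h33
  · simpa using pw_zero a
  · simpa using sc C.hR q.h31
  · simpa using pw_zero b
  · simpa using sc C.hR q.h32
  · simpa using sc C.hR q.h10
  · simpa using pw_zero (a - 1)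
  · simpa using sc C.hR q.h20
  · simpa using pw_zero b
  · convert qb using 1
    ext i j
    fin_cases i <;> fin_cases j <;> simp [blk]

end matsec


section idx
variable {T : USetting F (Fin 4 → F)} 
variable {R : AddSubgroup F} {m a b : ℤ} {S : Set (Matrix (Fin 4) (Fin 4) F)} {K : Subgroup T.GU}

lemma uC_mul {x y z x' y' z' : F} (hc : T.conj T.ϖ = T.ϖ) (h : uC T x y z) (h' : uC T x' y' z') :
    uC T (x' - x) (y' - y) (T.conj z + z' + T.ϖ⁻¹ * (x * T.conj x') + y * T.conj y') := by
  unfold uC at *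
  simp only [map_add, map_sub, map_mul, map_inv₀, hc, T.conj_invol]
  linear_combination h + h'

lemma uE_inv_mul (hform : T.IsU4Form) (hc : T.conj T.ϖ = T.ϖ) {x y z x' y' z' : F}
    (h : uC T x y z) (h' : uC T x' y' z') :
    (uE T x y z)⁻¹ * uE T x' y' z' =
      uE T (x' - x) (y' - y) (T.conj z + z' + T.ϖ⁻¹ * (x * T.conj x') + y * T.conj y') := by
  rw [uE_inv hform hc h]
  apply mat_inj
  rw [mat_mul, mat_uE hform hc (uC_inv h), mat_uE hform hc h', mat_uE hform hc (uC_mul hc h h'),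
    uM_mul]
  congr 1 <;> ring

lemma Ctx.coset_eq (C : Ctx T R m a b S K) {g : T.GU} {t : ℤ} (hg : mat T g = dM T t)
    {x y z x' y' z' : F} (h : uC T x y z) (h' : uC T x' y' z') :
    ((uE T x y z * g : T.GU) : T.GU ⧸ K) = ((uE T x' y' z' * g : T.GU) : T.GU ⧸ K) ↔
    pw T R (a + t) (x' - x) ∧ pw T R (b + t) (y' - y) ∧
      pw T (OO T) (m + 2 * t) (T.conj z + z' + T.ϖ⁻¹ * (x * T.conj x') + y * T.conj y') := by
  have e : (uE T x y z * g)⁻¹ * (uE T x' y' z' * g) =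
      g⁻¹ * ((uE T x y z)⁻¹ * uE T x' y' z') * g := by group
  rw [QuotientGroup.eq, e, uE_inv_mul C.hform C.hc h h',
    conj_uE C.hform C.hc hg (uC_mul C.hc h h'), C.uE_mem (uC_scale C.hc (uC_mul C.hc h h') t),
    pw_shift, pw_shift, pw_shift]
  simp only [sub_neg_eq_add]

lemma Ctx.index (C : Ctx T R m a b S K) {s i2 si : F} (hU : UData T s i2 si)
    {g : T.GU} {t : ℕ} (hg : mat T g = dM T t)
    {ι : Type w} {f : ι → F} (hf : Trans T R t f)
    {κ : Type w} {f0 : κ → F} (hf0 : Trans T (R0 T) ((2 * t : ℕ) : ℤ) f0) :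
    T.dcIndex K g = Nat.card ι ^ 2 * Nat.card κ := by
  have h0 := T.ϖ_ne_zero
  have hc := C.hc
  have hOO := rprop_OO T
  let X : ι → F := fun i => T.ϖ ^ a * f i
  let Y : ι → F := fun i => T.ϖ ^ b * f i
  let Z : ι → ι → κ → F := fun i j k =>
    -(i2 * (T.ϖ⁻¹ * (X i * T.conj (X i)) + Y j * T.conj (Y j))) + s * (T.ϖ ^ m * f0 k)
  have hX : ∀ i, pw T R a (X i) := fun i => ⟨f i, hf.1 i, rfl⟩
  have hY : ∀ i, pw T R b (Y i) := fun i => ⟨f i, hf.1 i, rfl⟩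
  have hnorm : ∀ {r : ℤ} {x y : F}, pw T R (a + r) x → pw T R (b + r) y →
      pw T (OO T) (m + 2 * r) (T.ϖ⁻¹ * (x * T.conj x) + y * T.conj y) := by
    intro r x y hx hy
    apply pw_add
    · rw [← zpow_neg_one, pw_shift]
      refine pw_mono hOO ?_ (pw_mul hOO (pw_OO C.hR hx) (pw_conj hOO hc (pw_OO C.hR hx)))
      have := C.ha2; omega
    · refine pw_mono hOO ?_ (pw_mul hOO (pw_OO C.hR hy) (pw_conj hOO hc (pw_OO C.hR hy)))
      have := C.hb2; omega
  have hcross : ∀ {x y x' y' : F}, pw T R a x → pw T R b y → pw T R a x' → pw T R b y' →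
      pw T (OO T) m (T.ϖ⁻¹ * (x * T.conj x') + y * T.conj y') := by
    intro x y x' y' hx hy hx' hy'
    apply pw_add
    · rw [← zpow_neg_one, pw_shift]
      refine pw_mono hOO ?_ (pw_mul hOO (pw_OO C.hR hx) (pw_conj hOO hc (pw_OO C.hR hx')))
      have := C.ha2; omega
    · refine pw_mono hOO ?_ (pw_mul hOO (pw_OO C.hR hy) (pw_conj hOO hc (pw_OO C.hR hy')))
      have := C.hb2; omega
  have hZc : ∀ i j k, T.conj (Z i j k) =
      -(i2 * (T.ϖ⁻¹ * (X i * T.conj (X i)) + Y j * T.conj (Y j))) - s * (T.ϖ ^ m * f0 k) := by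
    intro i j k
    simp only [Z, map_add, map_neg, map_mul, map_inv₀, map_zpow₀, hc, hU.ci2, hU.cs,
      T.conj_invol, (hf0.1 k).2]
    ring
  have hC : ∀ i j k, uC T (X i) (Y j) (Z i j k) := by
    intro i j k
    unfold uC
    rw [hZc]
    simp only [Z]
    linear_combination (-(T.ϖ⁻¹ * (X i * T.conj (X i)) + Y j * T.conj (Y j))) * hU.h2
  have hZ : ∀ i j k, pw T (OO T) m (Z i j k) := by
    intro i j k
    apply pw_add
    · apply pw_neg
      rw [mul_comm]
      have := hnorm (r := 0) (x := X i) (y := Y j) (by simpa using hX i) (by simpa using hY j)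
      exact pw_mulO hOO (by simpa using this) hU.i2O
    · rw [mul_comm]
      exact pw_mulO hOO ⟨_, (hf0.1 k).1, rfl⟩ hU.sO
  let Φ : (ι × ι) × κ → ((fun a : T.GU => (QuotientGroup.mk a : T.GU ⧸ K)) '' T.dCoset K g) :=
    fun p => ⟨QuotientGroup.mk (uE T (X p.1.1) (Y p.1.2) (Z p.1.1 p.1.2 p.2) * g),
      ⟨_, ⟨uE T (X p.1.1) (Y p.1.2) (Z p.1.1 p.1.2 p.2),
        (C.uE_mem (hC _ _ _)).2 ⟨hX _, hY _, hZ _ _ _⟩, 1, K.one_mem, by rw [mul_one]⟩, rfl⟩⟩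
  have hΦ : Function.Bijective Φ := by
    constructor
    · rintro ⟨⟨i, j⟩, k⟩ ⟨⟨i', j'⟩, k'⟩ he
      have he := (C.coset_eq hg (hC _ _ _) (hC _ _ _)).1 (congrArg Subtype.val he)
      simp only at he
      obtain ⟨e1, e2, e3⟩ := he
      have hi : i = i' := by
        symm; apply hf.2.2
        have : X i' - X i = T.ϖ ^ a * (f i' - f i) := by simp only [X]; ring
        rw [this, pw_shift] at e1
        simpa using e1
      have hj : j = j' := by
        symm; apply hf.2.2
        have : Y j' - Y j = T.ϖ ^ b * (f j' - f j) := by simp only [Y]; ring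
        rw [this, pw_shift] at e2
        simpa using e2
      subst hi hj
      have hk : k = k' := by
        symm; apply hf0.2.2
        rw [hZc] at e3
        have e4 : -(i2 * (T.ϖ⁻¹ * (X i * T.conj (X i)) + Y j * T.conj (Y j))) -
            s * (T.ϖ ^ m * f0 k) + Z i j k' + T.ϖ⁻¹ * (X i * T.conj (X i)) + Y j * T.conj (Y j)
            = T.ϖ ^ m * (s * (f0 k' - f0 k)) := by
          simp only [Z]
          linear_combination (-(T.ϖ⁻¹ * (X i * T.conj (X i)) + Y j * T.conj (Y j))) * hU.h2
        rw [e4, pw_shift] at e3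
        have e5 := pw_mulO hOO e3 hU.siO
        have e6 : s * (f0 k' - f0 k) * si = f0 k' - f0 k := by
          linear_combination (f0 k' - f0 k) * hU.hs
        rw [e6] at e5
        obtain ⟨r, hr, er⟩ := e5
        have ee : (m + 2 * (t : ℤ) - m) = ((2 * t : ℕ) : ℤ) := by push_cast; ring
        rw [ee] at er
        refine ⟨r, ⟨hr, ?_⟩, er⟩
        have := congrArg T.conj er
        rw [map_sub, (hf0.1 _).2, (hf0.1 _).2, map_mul, map_zpow₀, hc, er] at this
        exact (mul_left_cancel₀ (zpow_ne_zero _ h0) this).symm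
      rw [hk]
    · rintro ⟨_, ⟨_, ⟨k1, hk1, k2, hk2, rfl⟩, rfl⟩⟩
      obtain ⟨x, y, z, hu, huK, hkg⟩ := C.factor hg hk1
      obtain ⟨hx, hy, hz⟩ := (C.uE_mem hu).1 huK
      have hx' := hx
      have hy' := hy
      obtain ⟨x1, hx1, ex⟩ := hx'
      obtain ⟨y1, hy1, ey⟩ := hy'
      obtain ⟨i, hi⟩ := hf.2.1 x1 hx1
      obtain ⟨j, hj⟩ := hf.2.1 y1 hy1
      have dx : pw T R (a + t) (X i - x) := by
        have : X i - x = T.ϖ ^ a * (-(x1 - f i)) := by rw [ex]; simp only [X]; ring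
        rw [this, pw_shift]
        simpa using pw_neg hi
      have dy : pw T R (b + t) (Y j - y) := by
        have : Y j - y = T.ϖ ^ b * (-(y1 - f j)) := by rw [ey]; simp only [Y]; ring
        rw [this, pw_shift]
        simpa using pw_neg hj
      set P := T.conj z + -(i2 * (T.ϖ⁻¹ * (X i * T.conj (X i)) + Y j * T.conj (Y j))) +
        (T.ϖ⁻¹ * (x * T.conj (X i)) + y * T.conj (Y j)) with hP
      have hPm : pw T (OO T) m P := by
        apply pw_add (pw_add (pw_conj hOO hc hz) _) (hcross hx hy (hX i) (hY j))
        apply pw_neg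
        rw [mul_comm]
        exact pw_mulO hOO (hcross (hX i) (hY j) (hX i) (hY j)) hU.i2O
      have hPP : pw T (OO T) (m + 2 * t) (P + T.conj P) := by
        have := pw_neg (hnorm dx dy)
        convert this using 1
        rw [hP]
        simp only [map_add, map_sub, map_mul, map_inv₀, hc, T.conj_invol, map_neg, hU.ci2]
        unfold uC at hu
        linear_combination hu -
          (T.ϖ⁻¹ * (X i * T.conj (X i)) + Y j * T.conj (Y j)) * hU.h2
      obtain ⟨p, hp, ep⟩ := hPm
      obtain ⟨k, hk⟩ := hf0.2.1 _ (R0 T |>.neg_mem (hU.im hp))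
      refine ⟨((i, j), k), Subtype.ext ?_⟩
      have e1 : (QuotientGroup.mk (k1 * g * k2) : T.GU ⧸ K) =
          QuotientGroup.mk (uE T x y z * g) := by
        rw [eq_comm, QuotientGroup.eq]
        have : (uE T x y z * g)⁻¹ * (k1 * g * k2) = (g⁻¹ * ((uE T x y z)⁻¹ * k1) * g) * k2 := by
          group
        rw [this]; exact K.mul_mem hkg hk2
      change (QuotientGroup.mk _ : T.GU ⧸ K) = QuotientGroup.mk (k1 * g * k2)
      rw [e1, eq_comm, C.coset_eq hg hu (hC _ _ _)]
      refine ⟨dx, dy, ?_⟩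
      have e2 : T.conj z + Z i j k + T.ϖ⁻¹ * (x * T.conj (X i)) + y * T.conj (Y j) =
          i2 * (P + T.conj P) + s * (T.ϖ ^ m * (f0 k - -(si * (i2 * (p - T.conj p))))) := by
        have cp : T.conj P = T.ϖ ^ m * T.conj p := by rw [ep, map_mul, map_zpow₀, hc]
        have : T.conj z + Z i j k + T.ϖ⁻¹ * (x * T.conj (X i)) + y * T.conj (Y j) =
          P + s * (T.ϖ ^ m * f0 k) := by rw [hP]; simp only [Z]; ring
        rw [this]
        have d := hU.dec P
        rw [cp, ep] at *
        linear_combination d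
      rw [e2]
      apply pw_add
      · rw [mul_comm i2]; exact pw_mulO hOO hPP hU.i2O
      · rw [mul_comm s]
        apply pw_mulO hOO _ hU.sO
        rw [pw_shift]
        have := pw_neg hk
        rw [neg_sub] at this
        obtain ⟨r, hr, er⟩ := this
        refine ⟨r, hr.1, ?_⟩
        rw [er]; congr 2; push_cast; ring
  unfold USetting.dcIndex
  rw [← Nat.card_eq_of_bijective Φ hΦ, Nat.card_prod, Nat.card_prod, pow_two]

lemma dc_left (K : Subgroup T.GU) {s : T.GU} (hs : ∀ k, k ∈ K → s⁻¹ * k * s ∈ K)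
    (hs' : ∀ k, k ∈ K → s * k * s⁻¹ ∈ K) (g : T.GU) :
    T.dcIndex K (s * g) = T.dcIndex K g := by
  unfold USetting.dcIndex
  let e : (T.GU ⧸ K) ≃ (T.GU ⧸ K) := MulAction.toPerm s
  symm
  apply Nat.card_congr
  refine (e.image _).trans (Equiv.setCongr ?_)
  ext c
  constructor
  · rintro ⟨_, ⟨_, ⟨x, hx, y, hy, rfl⟩, rfl⟩, rfl⟩
    refine ⟨s * (x * g * y), ⟨s * x * s⁻¹, hs' _ hx, y, hy, by group⟩, rfl⟩
  · rintro ⟨_, ⟨x, hx, y, hy, rfl⟩, rfl⟩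
    refine ⟨_, ⟨(s⁻¹ * x * s) * g * y, ⟨_, hs _ hx, y, hy, rfl⟩, rfl⟩, ?_⟩
    change (QuotientGroup.mk (s * ((s⁻¹ * x * s) * g * y)) : T.GU ⧸ K) = _
    congr 1
    group

lemma dc_right (K : Subgroup T.GU) {s : T.GU} (hs : ∀ k, k ∈ K → s⁻¹ * k * s ∈ K)
    (hs' : ∀ k, k ∈ K → s * k * s⁻¹ ∈ K) (g : T.GU) :
    T.dcIndex K (g * s) = T.dcIndex K g := by
  unfold USetting.dcIndex
  have w1 : ∀ a b : T.GU, (QuotientGroup.mk (a * s) : T.GU ⧸ K) = QuotientGroup.mk (b * s) ↔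
      (QuotientGroup.mk a : T.GU ⧸ K) = QuotientGroup.mk b := by
    intro a b
    rw [QuotientGroup.eq, QuotientGroup.eq]
    have e : (a * s)⁻¹ * (b * s) = s⁻¹ * (a⁻¹ * b) * s := by group
    rw [e]
    constructor
    · intro h; have := hs' _ h; convert this using 1; group
    · exact hs _
  let Φ : ((fun a : T.GU => (QuotientGroup.mk a : T.GU ⧸ K)) '' T.dCoset K g) →
    ((fun a : T.GU => (QuotientGroup.mk a : T.GU ⧸ K)) '' T.dCoset K (g * s)) := fun p =>
      ⟨QuotientGroup.mk (p.2.choose * s), by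
        obtain ⟨x, hx, y, hy, e⟩ := p.2.choose_spec.1
        refine ⟨_, ⟨x, hx, s⁻¹ * y * s, hs _ hy, ?_⟩, rfl⟩
        rw [e]; group⟩
  symm
  apply Nat.card_eq_of_bijective Φ
  constructor
  · intro p p' h
    have h := (w1 _ _).1 (congrArg Subtype.val h)
    apply Subtype.ext
    rw [← p.2.choose_spec.2, ← p'.2.choose_spec.2]
    exact h
  · rintro ⟨_, ⟨_, ⟨x, hx, y, hy, rfl⟩, rfl⟩⟩
    have hmem : x * g * (s * y * s⁻¹) ∈ T.dCoset K g := ⟨x, hx, _, hs' _ hy, rfl⟩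
    refine ⟨⟨_, ⟨_, hmem, rfl⟩⟩, Subtype.ext ?_⟩
    have hp : ∃ a, a ∈ T.dCoset K g ∧ (QuotientGroup.mk a : T.GU ⧸ K) =
      QuotientGroup.mk (x * g * (s * y * s⁻¹)) := ⟨_, hmem, rfl⟩
    change (QuotientGroup.mk (hp.choose * s) : T.GU ⧸ K) = QuotientGroup.mk (x * (g * s) * y)
    have e : x * (g * s) * y = (x * g * (s * y * s⁻¹)) * s := by group
    rw [e, w1]
    exact hp.choose_spec.2

/-- swapped matrix under `s₁` -/
lemma Ctx.s1_conj (C : Ctx T R m a b S K) {s : T.GU} (hs : mat T s = USetting.s1Mat) {k : T.GU}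
    (hk : k ∈ K) : s * k * s ∈ K := by
  obtain ⟨q, qb⟩ := (C.hS _).1 ((C.hK k).1 hk)
  have e : mat T (s * k * s) - 1 =
      Matrix.of (fun i j => (mat T k - 1) (Equiv.swap 0 3 i) (Equiv.swap 0 3 j)) := by
    rw [mat_mul, mat_mul, hs]
    generalize mat T k = M
    unfold USetting.s1Mat
    have a0 : (Equiv.swap (0 : Fin 4) 3) 0 = 3 := by decide
    have a1 : (Equiv.swap (0 : Fin 4) 3) 1 = 1 := by decide
    have a2 : (Equiv.swap (0 : Fin 4) 3) 2 = 2 := by decide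
    have a3 : (Equiv.swap (0 : Fin 4) 3) 3 = 0 := by decide
    ext i j
    fin_cases i <;> fin_cases j <;>
      simp [Matrix.mul_apply, Matrix.vecMul, dotProduct, Fin.sum_univ_four, a0, a1, a2, a3]
  rw [C.hK, C.hS, e]
  have a0 : (Equiv.swap (0 : Fin 4) 3) 0 = 3 := by decide
  have a1 : (Equiv.swap (0 : Fin 4) 3) 1 = 1 := by decide
  have a2 : (Equiv.swap (0 : Fin 4) 3) 2 = 2 := by decide
  have a3 : (Equiv.swap (0 : Fin 4) 3) 3 = 0 := by decide
  refine ⟨⟨?_, ?_, ?_, ?_, ?_, ?_, ?_, ?_, ?_, ?_, ?_, ?_⟩, ?_⟩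
  all_goals simp only [Matrix.of_apply, blk, a0, a1, a2, a3]
  exacts [q.h33, q.h30, q.h03, q.h00, q.h31, q.h01, q.h32, q.h02, q.h13, q.h10, q.h23, q.h20, qb]

lemma Ctx.final (C : Ctx T R m a b S K) {s₁ s₂ : T.GU} (hs₁ : mat T s₁ = USetting.s1Mat)
    (hs₂ : mat T s₂ = T.s2Mat) {N : ℕ}
    (hN : ∀ (g : T.GU) (t : ℕ), mat T g = dM T t → T.dcIndex K g = N ^ t) (t : ℕ) :
    T.dcIndex K ((s₁ * s₂) ^ t) = N ^ t ∧ T.dcIndex K ((s₁ * s₂) ^ t * s₁) = N ^ t ∧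
    T.dcIndex K ((s₂ * s₁) ^ t) = N ^ t ∧ T.dcIndex K ((s₂ * s₁) ^ t * s₂) = N ^ (t + 1) := by
  have h0 := T.ϖ_ne_zero
  have s11 : s₁ * s₁ = 1 := by
    apply mat_inj
    rw [mat_mul, hs₁, mat_one]
    unfold USetting.s1Mat
    ext i j
    fin_cases i <;> fin_cases j <;> simp
  have s1i : s₁⁻¹ = s₁ := inv_eq_of_mul_eq_one_right s11
  have d1 : mat T (s₁ * s₂) = dM T 1 := by
    rw [mat_mul, hs₁, hs₂]
    unfold USetting.s1Mat USetting.s2Mat dM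
    ext i j
    fin_cases i <;> fin_cases j <;> simp
  have dt : ∀ t : ℕ, mat T ((s₁ * s₂) ^ t) = dM T t := by
    intro t
    induction t with
    | zero => rw [pow_zero, mat_one]; exact dM_zero.symm
    | succ t ih => rw [pow_succ, mat_mul, ih, d1, dM_mul]; push_cast; rfl
  have n1 : ∀ k, k ∈ K → s₁⁻¹ * k * s₁ ∈ K := fun k hk => by rw [s1i]; exact C.s1_conj hs₁ hk
  have n2 : ∀ k, k ∈ K → s₁ * k * s₁⁻¹ ∈ K := fun k hk => by rw [s1i]; exact C.s1_conj hs₁ hk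
  have e21 : (s₂ * s₁) ^ t = s₁ * ((s₁ * s₂) ^ t * s₁) := by
    have := conj_pow (a := s₁) (b := s₁ * s₂) (i := t)
    rw [s1i] at this
    rw [← mul_assoc s₁ ((s₁ * s₂) ^ t), ← this]
    congr 1
    rw [← mul_assoc s₁ s₁, s11, one_mul]
  refine ⟨hN _ _ (dt t), ?_, ?_, ?_⟩
  · rw [dc_right K n1 n2]; exact hN _ _ (dt t)
  · rw [e21, dc_left K n1 n2, dc_right K n1 n2]; exact hN _ _ (dt t)
  · have : (s₂ * s₁) ^ t * s₂ = s₁ * (s₁ * s₂) ^ (t + 1) := by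
      rw [e21, pow_succ]; simp only [mul_assoc]
    rw [this, dc_left K n1 n2]; exact hN _ _ (dt (t + 1))

end idx


section lat
variable {T : USetting F (Fin 4 → F)} 

lemma mem_O_iff {x : F} : x ∈ T.O ↔ pw T (OO T) 0 x :=
  ⟨fun h => ⟨x, h, by simp⟩, fun h => pw_mem le_rfl h⟩
lemma mem_pF_iff {x : F} : x ∈ T.pF ↔ pw T (OO T) 1 x := by
  unfold pw; rw [zpow_one]; rfl
lemma mul_mem_iff {x : F} : T.ϖ * x ∈ T.O ↔ pw T (OO T) (-1) x := by
  rw [mem_O_iff]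
  have := pw_shift (T := T) (R := OO T) (i := 0) (j := 1) (x := x)
  rw [zpow_one] at this
  simpa using this
lemma mul_pw {x : F} : pw T (OO T) 0 (T.ϖ * x) ↔ pw T (OO T) (-1) x := by
  rw [← mem_O_iff]; exact mul_mem_iff

lemma pw_inv {i k : ℤ} {x : F} : pw T (OO T) i ((T.ϖ ^ k)⁻¹ * x) ↔ pw T (OO T) (i + k) x := by
  rw [← zpow_neg, pw_shift, sub_neg_eq_add]

/-- offsets -/
def rr : Fin 4 → ℤ := ![3, 5, 2, 1]

lemma lat_iff {Λ : T.LatSeq} (hΛ : T.IsLam4 Λ) (i : ℤ) (v : Fin 4 → F) :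
    v ∈ Λ.L i ↔ pw T (OO T) ((i + 2) / 6) (v 0) ∧ pw T (OO T) (i / 6) (v 1) ∧
      pw T (OO T) ((i + 3) / 6) (v 2) ∧ pw T (OO T) ((i + 4) / 6) (v 3) := by
  obtain ⟨-, h⟩ := hΛ
  obtain ⟨h0, h1, h2, h3, h4, h5⟩ := h (i / 6)
  have hz : ∀ k : ℤ, T.ϖ ^ k ≠ 0 := fun k => zpow_ne_zero _ T.ϖ_ne_zero
  have hcase : i = 6 * (i / 6) ∨ i = 6 * (i / 6) + 1 ∨ i = 6 * (i / 6) + 2 ∨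
    i = 6 * (i / 6) + 3 ∨ i = 6 * (i / 6) + 4 ∨ i = 6 * (i / 6) + 5 := by omega
  generalize i / 6 = k at *
  have mono : ∀ {p q : ℤ} {x : F}, p = q → (pw T (OO T) p x ↔ pw T (OO T) q x) := by
    rintro p _ x rfl; rfl
  rcases hcase with rfl | rfl | rfl | rfl | rfl | rfl
  · rw [h0, Set.mem_smul_set_iff_inv_smul_mem₀ (hz _)]
    simp only [USetting.N0, Set.mem_setOf_eq, Pi.smul_apply, smul_eq_mul, mem_O_iff, pw_inv,
      Fin.forall_fin_succ]
    simp
    rw [mono (show (6 * k + 2) / 6 = k by omega), mono (show (6 * k + 3) / 6 = k by omega),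
      mono (show (6 * k + 4) / 6 = k by omega)]
  · rw [h1, Set.mem_smul_set_iff_inv_smul_mem₀ (hz _)]
    simp only [USetting.N0, Set.mem_setOf_eq, Pi.smul_apply, smul_eq_mul, mem_O_iff, pw_inv,
      Fin.forall_fin_succ]
    simp
    rw [mono (show (6 * k + 1 + 2) / 6 = k by omega), mono (show (6 * k + 1 + 3) / 6 = k by omega),
      mono (show (6 * k + 1 + 4) / 6 = k by omega)]
  · rw [h2, Set.mem_smul_set_iff_inv_smul_mem₀ (hz _)]
    simp only [USetting.N1, Set.mem_setOf_eq, Pi.smul_apply, smul_eq_mul, mem_O_iff, pw_inv,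
      Fin.forall_fin_succ, mem_pF_iff]
    simp
    rw [mono (show (6 * k + 2 + 2) / 6 = k by omega), mono (show (6 * k + 2 + 3) / 6 = k by omega),
      mono (show (6 * k + 2 + 4) / 6 = 1 + k by omega)]
    constructor
    · rintro ⟨⟨a, b, c, d⟩, e⟩; exact ⟨a, b, c, e⟩
    · rintro ⟨a, b, c, e⟩; exact ⟨⟨a, b, c, pw_mono (rprop_OO T) (by omega) e⟩, e⟩
  · rw [h3, Set.mem_smul_set_iff_inv_smul_mem₀ (hz _)]
    simp only [USetting.N1s, Set.mem_setOf_eq, Pi.smul_apply, smul_eq_mul, mul_pw, mem_O_iff,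
      pw_inv]
    rw [mono (show (6 * k + 3 + 2) / 6 = -1 + (k + 1) by omega),
      mono (show k = -1 + (k + 1) by omega),
      mono (show (6 * k + 3 + 3) / 6 = 0 + (k + 1) by omega),
      mono (show (6 * k + 3 + 4) / 6 = 0 + (k + 1) by omega)]
  · rw [h4, Set.mem_smul_set_iff_inv_smul_mem₀ (hz _)]
    simp only [USetting.N0s, Set.mem_setOf_eq, Pi.smul_apply, smul_eq_mul, mul_pw, mem_O_iff,
      pw_inv]
    rw [mono (show (6 * k + 4 + 2) / 6 = 0 + (k + 1) by omega),
      mono (show k = -1 + (k + 1) by omega),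
      mono (show (6 * k + 4 + 3) / 6 = 0 + (k + 1) by omega),
      mono (show (6 * k + 4 + 4) / 6 = 0 + (k + 1) by omega)]
  · rw [h5, Set.mem_smul_set_iff_inv_smul_mem₀ (hz _)]
    simp only [USetting.N0s, Set.mem_setOf_eq, Pi.smul_apply, smul_eq_mul, mul_pw, mem_O_iff,
      pw_inv]
    rw [mono (show (6 * k + 5 + 2) / 6 = 0 + (k + 1) by omega),
      mono (show k = -1 + (k + 1) by omega),
      mono (show (6 * k + 5 + 3) / 6 = 0 + (k + 1) by omega),
      mono (show (6 * k + 5 + 4) / 6 = 0 + (k + 1) by omega)]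

lemma lat_iff' {Λ : T.LatSeq} (hΛ : T.IsLam4 Λ) (i : ℤ) (v : Fin 4 → F) :
    v ∈ Λ.L i ↔ ∀ j, pw T (OO T) ((i + 5 - rr j) / 6) (v j) := by
  rw [lat_iff hΛ]
  have e0 : (i + 5 - rr 0) / 6 = (i + 2) / 6 := by simp [rr]; omega
  have e1 : (i + 5 - rr 1) / 6 = i / 6 := by simp [rr]
  have e2 : (i + 5 - rr 2) / 6 = (i + 3) / 6 := by simp [rr]; omega
  have e3 : (i + 5 - rr 3) / 6 = (i + 4) / 6 := by simp [rr]; omega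
  constructor
  · rintro ⟨h0, h1, h2, h3⟩ j
    fin_cases j
    · change pw T (OO T) ((i + 5 - rr 0) / 6) (v 0); rw [e0]; exact h0
    · change pw T (OO T) ((i + 5 - rr 1) / 6) (v 1); rw [e1]; exact h1
    · change pw T (OO T) ((i + 5 - rr 2) / 6) (v 2); rw [e2]; exact h2
    · change pw T (OO T) ((i + 5 - rr 3) / 6) (v 3); rw [e3]; exact h3
  · intro h
    have h0 := h 0
    have h1 := h 1
    have h2 := h 2
    have h3 := h 3
    rw [e0] at h0
    rw [e1] at h1
    rw [e2] at h2
    rw [e3] at h3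
    exact ⟨h0, h1, h2, h3⟩

lemma aFil_iff {Λ : T.LatSeq} (hΛ : T.IsLam4 Λ) (k : ℤ) (X : Matrix (Fin 4) (Fin 4) F) :
    Matrix.toLin' X ∈ T.aFil Λ k ↔ ∀ i j, pw T (OO T) ((rr j + k + 5 - rr i) / 6) (X i j) := by
  unfold USetting.aFil
  rw [Set.mem_setOf_eq]
  constructor
  · intro h i j
    have hj : (Pi.single j 1 : Fin 4 → F) ∈ Λ.L (rr j) := by
      rw [lat_iff' hΛ]
      intro l
      by_cases hl : l = j
      · subst hl
        rw [Pi.single_eq_same, show (rr l + 5 - rr l) / 6 = 0 by omega]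
        exact mem_O_iff.1 T.O.one_mem
      · rw [Pi.single_eq_of_ne hl]; exact pw_zero _
    have := h _ _ hj
    rw [lat_iff' hΛ] at this
    have := this i
    rw [Matrix.toLin'_apply, Matrix.mulVec_single_one] at this
    exact this
  · intro h l v hv
    rw [lat_iff' hΛ] at hv ⊢
    intro i
    rw [Matrix.toLin'_apply, Matrix.mulVec, dotProduct, Fin.sum_univ_four]
    have key : ∀ j, pw T (OO T) ((l + k + 5 - rr i) / 6) (X i j * v j) := fun j =>
      pw_mono (rprop_OO T) (by omega) (pw_mul (rprop_OO T) (h i j) (hv j))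
    exact pw_add (pw_add (pw_add (key 0) (key 1)) (key 2)) (key 3)

variable {y y' : F} {bM : Matrix (Fin 4) (Fin 4) F}

/-- explicit centralizer -/
structure BC (y y' : F) (X : Matrix (Fin 4) (Fin 4) F) : Prop where
  h01 : X 0 1 = 0
  h02 : X 0 2 = 0
  h31 : X 3 1 = 0
  h32 : X 3 2 = 0
  h10 : X 1 0 = 0
  h13 : X 1 3 = 0
  h20 : X 2 0 = 0
  h23 : X 2 3 = 0
  hd : X 1 1 = X 2 2
  ho : X 1 2 * y' = y * X 2 1

/-- explicit orthogonal complement -/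
structure BP (y y' : F) (X : Matrix (Fin 4) (Fin 4) F) : Prop where
  h00 : X 0 0 = 0
  h03 : X 0 3 = 0
  h30 : X 3 0 = 0
  h33 : X 3 3 = 0
  hd : X 1 1 + X 2 2 = 0
  ho : X 1 2 * y' + y * X 2 1 = 0

lemma bc_iff (hy : y ≠ 0) (hy' : y' ≠ 0)
    (hb : bM = !![0, 0, 0, 0; 0, 0, y, 0; 0, y', 0, 0; 0, 0, 0, 0])
    (X : Matrix (Fin 4) (Fin 4) F) :
    Matrix.toLin' X ∈ USetting.Bcent (Matrix.toLin' bM) ↔ BC y y' X := by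
  unfold USetting.Bcent
  rw [Set.mem_setOf_eq, Module.End.mul_eq_comp, Module.End.mul_eq_comp, ← Matrix.toLin'_mul,
    ← Matrix.toLin'_mul, Matrix.toLin'.injective.eq_iff]
  constructor
  · intro h
    have h := fun i j => congrFun (congrFun h i) j
    rw [hb] at h
    simp only [Matrix.mul_apply, Fin.sum_univ_four] at h
    constructor
    · simpa [hy] using h 0 2
    · simpa [hy'] using h 0 1
    · simpa [hy] using h 3 2
    · simpa [hy'] using h 3 1
    · simpa [hy'] using (h 2 0).symm
    · simpa [hy'] using (h 2 3).symm
    · simpa [hy] using (h 1 0).symm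
    · simpa [hy] using (h 1 3).symm
    · have := h 1 2
      simp at this
      apply mul_right_cancel₀ hy; rw [this]; ring
    · simpa using h 1 1
  · rintro ⟨h01, h02, h31, h32, h10, h13, h20, h23, hd, ho⟩
    rw [hb]
    ext i j
    fin_cases i <;> fin_cases j <;> simp [Matrix.mul_apply, Fin.sum_univ_four, *]
    · ring
    · ring
    · linear_combination -ho

lemma bp_iff (hy : y ≠ 0) (hy' : y' ≠ 0)
    (hb : bM = !![0, 0, 0, 0; 0, 0, y, 0; 0, y', 0, 0; 0, 0, 0, 0])
    (X : Matrix (Fin 4) (Fin 4) F) :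
    Matrix.toLin' X ∈ USetting.Bperp (Matrix.toLin' bM) ↔ BP y y' X := by
  have tr : ∀ Y : Matrix (Fin 4) (Fin 4) F,
      LinearMap.trace F _ (Matrix.toLin' X * Matrix.toLin' Y) = (X * Y).trace := by
    intro Y
    rw [Module.End.mul_eq_comp, ← Matrix.toLin'_mul, Matrix.trace_toLin'_eq]
  unfold USetting.Bperp
  rw [Set.mem_setOf_eq]
  constructor
  · intro h
    have h : ∀ Y, BC y y' Y → (X * Y).trace = 0 := fun Y hY => by
      rw [← tr]; exact h _ ((bc_iff hy hy' hb Y).2 hY)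
    simp only [Matrix.trace, Matrix.diag, Matrix.mul_apply, Fin.sum_univ_four] at h
    constructor
    · have := h !![1, 0, 0, 0; 0, 0, 0, 0; 0, 0, 0, 0; 0, 0, 0, 0] (by constructor <;> simp)
      simpa using this
    · have := h !![0, 0, 0, 0; 0, 0, 0, 0; 0, 0, 0, 0; 1, 0, 0, 0] (by constructor <;> simp)
      simpa using this
    · have := h !![0, 0, 0, 1; 0, 0, 0, 0; 0, 0, 0, 0; 0, 0, 0, 0] (by constructor <;> simp)
      simpa using this
    · have := h !![0, 0, 0, 0; 0, 0, 0, 0; 0, 0, 0, 0; 0, 0, 0, 1] (by constructor <;> simp)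
      simpa using this
    · have := h !![0, 0, 0, 0; 0, 1, 0, 0; 0, 0, 1, 0; 0, 0, 0, 0] (by constructor <;> simp)
      simpa using this
    · have := h !![0, 0, 0, 0; 0, 0, y, 0; 0, y', 0, 0; 0, 0, 0, 0] (by constructor <;> simp)
      simp at this
      linear_combination this
  · rintro ⟨h00, h03, h30, h33, hd, ho⟩ Y hY
    obtain ⟨Y, rfl⟩ := Matrix.toLin'.surjective Y
    rw [bc_iff hy hy' hb] at hY
    obtain ⟨g01, g02, g31, g32, g10, g13, g20, g23, gd, go⟩ := hY
    rw [tr]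
    simp only [Matrix.trace, Matrix.diag, Matrix.mul_apply, Fin.sum_univ_four,
      h00, h03, h30, h33, g01, g02, g31, g32, g10, g13, g20, g23]
    apply mul_left_cancel₀ hy
    linear_combination y * Y 1 1 * hd + Y 1 2 * ho - X 1 2 * go - y * X 2 2 * gd

lemma forall44 {P : Fin 4 → Fin 4 → Prop} (h00 : P 0 0) (h01 : P 0 1) (h02 : P 0 2) (h03 : P 0 3)
    (h10 : P 1 0) (h11 : P 1 1) (h12 : P 1 2) (h13 : P 1 3)
    (h20 : P 2 0) (h21 : P 2 1) (h22 : P 2 2) (h23 : P 2 3)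
    (h30 : P 3 0) (h31 : P 3 1) (h32 : P 3 2) (h33 : P 3 3) : ∀ i j, P i j := by
  intro i j
  fin_cases i <;> fin_cases j <;> assumption

variable {m n : ℤ}

lemma hS_J' {Λ : T.LatSeq} (hΛ : T.IsLam4 Λ) (hn : n = 6 * m - 3) (hy : y ≠ 0) (hy' : y' ≠ 0)
    (hb : bM = !![0, 0, 0, 0; 0, 0, y, 0; 0, y', 0, 0; 0, 0, 0, 0]) (a b : ℤ)
    (X : Matrix (Fin 4) (Fin 4) F) :
    Matrix.toLin' X ∈ T.aFil Λ n ∩ USetting.Bcent (Matrix.toLin' bM) ↔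
    QQ T ⊥ m a b X ∧ Matrix.toLin' (blk X) ∈ T.aFil Λ n ∩ USetting.Bcent (Matrix.toLin' bM) := by
  subst hn
  simp only [Set.mem_inter_iff, aFil_iff hΛ, bc_iff hy hy' hb]
  have e00 : (rr 0 + (6 * m - 3) + 5 - rr 0) / 6 = m := by omega
  have e33 : (rr 3 + (6 * m - 3) + 5 - rr 3) / 6 = m := by omega
  have e03 : (rr 3 + (6 * m - 3) + 5 - rr 0) / 6 = m := by simp [rr]; omega
  have e30 : (rr 0 + (6 * m - 3) + 5 - rr 3) / 6 = m := by simp [rr]; omega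
  constructor
  · rintro ⟨h, c⟩
    refine ⟨⟨e00 ▸ h 0 0, e03 ▸ h 0 3, e30 ▸ h 3 0, e33 ▸ h 3 3, ?_, ?_, ?_, ?_, ?_, ?_, ?_, ?_⟩,
      ?_, ?_⟩
    · rw [c.h01]; exact pw_zero _
    · rw [c.h31]; exact pw_zero _
    · rw [c.h02]; exact pw_zero _
    · rw [c.h32]; exact pw_zero _
    · rw [c.h10]; exact pw_zero _
    · rw [c.h13]; exact pw_zero _
    · rw [c.h20]; exact pw_zero _
    · rw [c.h23]; exact pw_zero _
    · apply forall44 <;> first | exact pw_zero _ | exact h _ _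
    · exact ⟨rfl, rfl, rfl, rfl, rfl, rfl, rfl, rfl, c.hd, c.ho⟩
  · rintro ⟨q, h, c⟩
    have z01 := pw_bot.1 q.h01
    have z02 := pw_bot.1 q.h02
    have z31 := pw_bot.1 q.h31
    have z32 := pw_bot.1 q.h32
    have z10 := pw_bot.1 q.h10
    have z13 := pw_bot.1 q.h13
    have z20 := pw_bot.1 q.h20
    have z23 := pw_bot.1 q.h23
    refine ⟨?_, ⟨z01, z02, z31, z32, z10, z13, z20, z23, c.hd, c.ho⟩⟩
    apply forall44
    · rw [e00]; exact q.h00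
    · rw [z01]; exact pw_zero _
    · rw [z02]; exact pw_zero _
    · rw [e03]; exact q.h03
    · rw [z10]; exact pw_zero _
    · exact h 1 1
    · exact h 1 2
    · rw [z13]; exact pw_zero _
    · rw [z20]; exact pw_zero _
    · exact h 2 1
    · exact h 2 2
    · rw [z23]; exact pw_zero _
    · rw [e30]; exact q.h30
    · rw [z31]; exact pw_zero _
    · rw [z32]; exact pw_zero _
    · rw [e33]; exact q.h33

lemma frak_iff {Λ : T.LatSeq} (hΛ : T.IsLam4 Λ) (hy : y ≠ 0) (hy' : y' ≠ 0)
    (hb : bM = !![0, 0, 0, 0; 0, 0, y, 0; 0, y', 0, 0; 0, 0, 0, 0])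
    (X : Matrix (Fin 4) (Fin 4) F) :
    Matrix.toLin' X ∈ T.frakJplus Λ n (Matrix.toLin' bM) ↔
    ∃ A B, X = A + B ∧ (∀ i j, pw T (OO T) ((rr j + n + 5 - rr i) / 6) (A i j)) ∧ BC y y' A ∧
      (∀ i j, pw T (OO T) ((rr j + (n / 2 + 1) + 5 - rr i) / 6) (B i j)) ∧ BP y y' B := by
  unfold USetting.frakJplus USetting.setAdd
  rw [Set.mem_setOf_eq]
  constructor
  · rintro ⟨A, ⟨hA, hA'⟩, B, ⟨hB, hB'⟩, e⟩
    obtain ⟨A, rfl⟩ := Matrix.toLin'.surjective A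
    obtain ⟨B, rfl⟩ := Matrix.toLin'.surjective B
    refine ⟨A, B, ?_, (aFil_iff hΛ _ _).1 hA, (bc_iff hy hy' hb _).1 hA',
      (aFil_iff hΛ _ _).1 hB, (bp_iff hy hy' hb _).1 hB'⟩
    apply Matrix.toLin'.injective
    rw [e, map_add]
  · rintro ⟨A, B, rfl, hA, hA', hB, hB'⟩
    exact ⟨_, ⟨(aFil_iff hΛ _ _).2 hA, (bc_iff hy hy' hb _).2 hA'⟩, _,
      ⟨(aFil_iff hΛ _ _).2 hB, (bp_iff hy hy' hb _).2 hB'⟩, map_add _ _ _⟩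

lemma hS_J {Λ : T.LatSeq} (hΛ : T.IsLam4 Λ) (hn : n = 6 * m - 3) (hy : y ≠ 0) (hy' : y' ≠ 0)
    (hb : bM = !![0, 0, 0, 0; 0, 0, y, 0; 0, y', 0, 0; 0, 0, 0, 0])
    (X : Matrix (Fin 4) (Fin 4) F) :
    Matrix.toLin' X ∈ T.frakJplus Λ n (Matrix.toLin' bM) ↔
    QQ T (OO T) m (m / 2 + 1) ((m + 1) / 2) X ∧
      Matrix.toLin' (blk X) ∈ T.frakJplus Λ n (Matrix.toLin' bM) := by
  rw [frak_iff hΛ hy hy' hb, frak_iff hΛ hy hy' hb]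
  subst hn
  have e00 : (rr 0 + (6 * m - 3) + 5 - rr 0) / 6 = m := by omega
  have e33 : (rr 3 + (6 * m - 3) + 5 - rr 3) / 6 = m := by omega
  have e03 : (rr 3 + (6 * m - 3) + 5 - rr 0) / 6 = m := by simp [rr]; omega
  have e30 : (rr 0 + (6 * m - 3) + 5 - rr 3) / 6 = m := by simp [rr]; omega
  have e01 : (rr 1 + ((6 * m - 3) / 2 + 1) + 5 - rr 0) / 6 = m / 2 + 1 := by simp [rr]; omega
  have e31 : (rr 1 + ((6 * m - 3) / 2 + 1) + 5 - rr 3) / 6 = m / 2 + 1 := by simp [rr]; omega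
  have e02 : (rr 2 + ((6 * m - 3) / 2 + 1) + 5 - rr 0) / 6 = (m + 1) / 2 := by simp [rr]; omega
  have e32 : (rr 2 + ((6 * m - 3) / 2 + 1) + 5 - rr 3) / 6 = (m + 1) / 2 := by simp [rr]; omega
  have e10 : (rr 0 + ((6 * m - 3) / 2 + 1) + 5 - rr 1) / 6 = m / 2 + 1 - 1 := by simp [rr]; omega
  have e13 : (rr 3 + ((6 * m - 3) / 2 + 1) + 5 - rr 1) / 6 = m / 2 + 1 - 1 := by simp [rr]; omega
  have e20 : (rr 0 + ((6 * m - 3) / 2 + 1) + 5 - rr 2) / 6 = (m + 1) / 2 := by simp [rr]; omega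
  have e23 : (rr 3 + ((6 * m - 3) / 2 + 1) + 5 - rr 2) / 6 = (m + 1) / 2 := by simp [rr]; omega
  constructor
  · rintro ⟨A, B, rfl, hA, cA, hB, pB⟩
    refine ⟨⟨?_, ?_, ?_, ?_, ?_, ?_, ?_, ?_, ?_, ?_, ?_, ?_⟩, blk A, blk B, ?_, ?_, ?_, ?_, ?_⟩
    · rw [Matrix.add_apply, pB.h00, add_zero]; exact e00 ▸ hA 0 0
    · rw [Matrix.add_apply, pB.h03, add_zero]; exact e03 ▸ hA 0 3
    · rw [Matrix.add_apply, pB.h30, add_zero]; exact e30 ▸ hA 3 0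
    · rw [Matrix.add_apply, pB.h33, add_zero]; exact e33 ▸ hA 3 3
    · rw [Matrix.add_apply, cA.h01, zero_add]; exact e01 ▸ hB 0 1
    · rw [Matrix.add_apply, cA.h31, zero_add]; exact e31 ▸ hB 3 1
    · rw [Matrix.add_apply, cA.h02, zero_add]; exact e02 ▸ hB 0 2
    · rw [Matrix.add_apply, cA.h32, zero_add]; exact e32 ▸ hB 3 2
    · rw [Matrix.add_apply, cA.h10, zero_add]; exact e10 ▸ hB 1 0
    · rw [Matrix.add_apply, cA.h13, zero_add]; exact e13 ▸ hB 1 3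
    · rw [Matrix.add_apply, cA.h20, zero_add]; exact e20 ▸ hB 2 0
    · rw [Matrix.add_apply, cA.h23, zero_add]; exact e23 ▸ hB 2 3
    · ext i j
      fin_cases i <;> fin_cases j <;> simp [blk]
    · apply forall44 <;> first | exact pw_zero _ | exact hA _ _
    · exact ⟨rfl, rfl, rfl, rfl, rfl, rfl, rfl, rfl, cA.hd, cA.ho⟩
    · apply forall44 <;> first | exact pw_zero _ | exact hB _ _
    · exact ⟨rfl, rfl, rfl, rfl, pB.hd, pB.ho⟩
  · rintro ⟨q, A, B, e, hA, cA, hB, pB⟩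
    have f11 := congrFun (congrFun e 1) 1
    have f12 := congrFun (congrFun e 1) 2
    have f21 := congrFun (congrFun e 2) 1
    have f22 := congrFun (congrFun e 2) 2
    simp [blk] at f11 f12 f21 f22
    refine ⟨!![X 0 0, 0, 0, X 0 3; 0, A 1 1, A 1 2, 0; 0, A 2 1, A 2 2, 0; X 3 0, 0, 0, X 3 3],
      !![0, X 0 1, X 0 2, 0; X 1 0, B 1 1, B 1 2, X 1 3; X 2 0, B 2 1, B 2 2, X 2 3;
        0, X 3 1, X 3 2, 0], ?_, ?_, ?_, ?_, ?_⟩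
    · ext i j
      fin_cases i <;> fin_cases j <;> simp [*]
    · apply forall44
      · rw [e00]; exact q.h00
      · exact pw_zero _
      · exact pw_zero _
      · rw [e03]; exact q.h03
      · exact pw_zero _
      · exact hA 1 1
      · exact hA 1 2
      · exact pw_zero _
      · exact pw_zero _
      · exact hA 2 1
      · exact hA 2 2
      · exact pw_zero _
      · rw [e30]; exact q.h30
      · exact pw_zero _
      · exact pw_zero _
      · rw [e33]; exact q.h33
    · exact ⟨rfl, rfl, rfl, rfl, rfl, rfl, rfl, rfl, cA.hd, cA.ho⟩
    · apply forall44
      · exact pw_zero _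
      · rw [e01]; exact q.h01
      · rw [e02]; exact q.h02
      · exact pw_zero _
      · rw [e10]; exact q.h10
      · exact hB 1 1
      · exact hB 1 2
      · rw [e13]; exact q.h13
      · rw [e20]; exact q.h20
      · exact hB 2 1
      · exact hB 2 2
      · rw [e23]; exact q.h23
      · exact pw_zero _
      · rw [e31]; exact q.h31
      · rw [e32]; exact q.h32
      · exact pw_zero _
    · exact ⟨rfl, rfl, rfl, rfl, pB.hd, pB.ho⟩

end lat

end U4Aux


open USetting in
/-- **Lemma 6.2.** For the non quasi-split unramified `U(4)`,
`Λ = Λ₄`, `n = 6m - 3`, `β = ϖ^{-m}(Y E₂₃ - ϖ Ȳ E₃₂)` with `Y ∈ o_F^×`,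
`J = (1 + 𝔍₊) ∩ G`, `J' = P_n(Λ) ∩ B`, and
`s₁ = E₁₄ + E₂₂ + E₃₃ + E₄₁`, `s₂ = ϖ⁻¹E₁₄ + E₂₂ + E₃₃ + ϖE₄₁ ∈ G_E`, one has,
for every `t ≥ 0`:
`[J'(s₁s₂)^t J' : J'] = [J'(s₁s₂)^t s₁ J' : J'] = [J'(s₂s₁)^t J' : J'] = q^{2t}`,
`[J'(s₂s₁)^t s₂ J' : J'] = q^{2(t+1)}`, and
`[J(s₁s₂)^t J : J] = [J(s₂s₁)^t J : J] = [J(s₁s₂)^t s₁ J : J] = q^{6t}`,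
`[J(s₂s₁)^t s₂ J : J] = q^{6(t+1)}`,
where `q` is the cardinality of the residue field of `F₀`. -/
theorem statement_18
    {F : Type u} [Field F] (T : USetting F (Fin 4 → F))
    (hodd : ¬ (2 ∣ T.residueChar))
    (hform : T.IsU4Form) (hunram : T.IsUnramifiedQuadratic)
    (F₀ : Type w) [Field F₀] [Algebra F₀ F] [FiniteDimensional F₀ F]
    (hfix : T.FixedField F₀) (hdeg : Module.finrank F₀ F = 2)
    -- `q = |o₀/p₀|`, the cardinality of the residue field of `F₀`
    (ϖ₀ : F₀) (hϖ₀ : algebraMap F₀ F ϖ₀ = T.ϖ)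
    (hϖ₀mem : ϖ₀ ∈ T.O.comap (algebraMap F₀ F))
    (q : ℕ)
    (hq : Nat.card
      ((T.O.comap (algebraMap F₀ F)) ⧸
        (Ideal.span {(⟨ϖ₀, hϖ₀mem⟩ : T.O.comap (algebraMap F₀ F))} :
          Ideal (T.O.comap (algebraMap F₀ F)))) = q)
    -- the stratum data
    (m : ℤ) (hm : 1 ≤ m) (n : ℤ) (hn : n = 6 * m - 3)
    (Λ : T.LatSeq) (hΛ : T.IsLam4 Λ)
    (Y : F) (hY : Y ∈ T.O) (hYu : ∃ z ∈ T.O, Y * z = 1)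
    (β : Module.End F (Fin 4 → F)) (hβ : β = Matrix.toLin' (T.betaMat m Y))
    -- `J = J₊ = (1 + 𝔍₊) ∩ G` and `J' = P_n(Λ) ∩ B` as subgroups
    (Jgrp J'grp : Subgroup T.GU)
    (hJgrp : (Jgrp : Set T.GU) = T.Jplusset Λ n β)
    (hJ'grp : (J'grp : Set T.GU) = T.Pset Λ n ∩ T.GEset β)
    -- the Weyl elements `s₁, s₂ ∈ G_E`
    (s₁ s₂ : T.GU)
    (hs₁ : T.toE s₁ = Matrix.toLin' s1Mat)
    (hs₂ : T.toE s₂ = Matrix.toLin' T.s2Mat) :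
    ∀ t : ℕ,
      T.dcIndex J'grp ((s₁ * s₂) ^ t) = q ^ (2 * t) ∧
      T.dcIndex J'grp ((s₁ * s₂) ^ t * s₁) = q ^ (2 * t) ∧
      T.dcIndex J'grp ((s₂ * s₁) ^ t) = q ^ (2 * t) ∧
      T.dcIndex J'grp ((s₂ * s₁) ^ t * s₂) = q ^ (2 * (t + 1)) ∧
      T.dcIndex Jgrp ((s₁ * s₂) ^ t) = q ^ (6 * t) ∧
      T.dcIndex Jgrp ((s₂ * s₁) ^ t) = q ^ (6 * t) ∧
      T.dcIndex Jgrp ((s₁ * s₂) ^ t * s₁) = q ^ (6 * t) ∧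
      T.dcIndex Jgrp ((s₂ * s₁) ^ t * s₂) = q ^ (6 * (t + 1)) := by
  have h0 := T.ϖ_ne_zero
  obtain ⟨s, i2, si, hU⟩ := U4Aux.exists_udata hodd hunram.1 hunram.2
  obtain ⟨f, hf⟩ := U4Aux.trans_base F₀ hfix ϖ₀ hϖ₀ hϖ₀mem
  have hϖR : ∀ r ∈ U4Aux.R0 T, T.ϖ * r ∈ U4Aux.R0 T := fun r hr =>
    ⟨T.O.mul_mem T.ϖ_mem hr.1, by rw [map_mul, hunram.1, hr.2]⟩
  have htr : ∀ t : ℕ, ∃ (ι' : Type w) (f' : ι' → F), U4Aux.Trans T (U4Aux.R0 T) t f' ∧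
      Nat.card ι' = q ^ t := by
    intro t
    obtain ⟨ι', f', h1, h2⟩ := U4Aux.trans_pow hϖR hf t
    exact ⟨ι', f', h1, by rw [h2, hq]⟩
  have hY0 : Y ≠ 0 := by
    rintro rfl
    obtain ⟨z, -, hz⟩ := hYu
    rw [zero_mul] at hz
    exact zero_ne_one hz
  have hcY0 : T.conj Y ≠ 0 := by
    rw [Ne, map_eq_zero_iff _ T.conj.injective]; exact hY0
  have hy : T.ϖ ^ (-m) * Y ≠ 0 := mul_ne_zero (zpow_ne_zero _ h0) hY0
  have hy' : -(T.ϖ ^ (1 - m) * T.conj Y) ≠ 0 :=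
    neg_ne_zero.2 (mul_ne_zero (zpow_ne_zero _ h0) hcY0)
  have hb : T.betaMat m Y = !![0, 0, 0, 0; 0, 0, T.ϖ ^ (-m) * Y, 0;
      0, -(T.ϖ ^ (1 - m) * T.conj Y), 0, 0; 0, 0, 0, 0] := by
    ext i j
    fin_cases i <;> fin_cases j <;> simp [USetting.betaMat]
  have hsub : ∀ k : T.GU, Matrix.toLin' (U4Aux.mat T k - 1) = T.toE k - 1 := by
    intro k
    rw [map_sub, ← U4Aux.toE_eq, Matrix.toLin'_one]; rfl
  have hz : ∀ k : ℤ, (0 : Module.End F (Fin 4 → F)) ∈ T.aFil Λ k := by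
    intro k
    have := (U4Aux.aFil_iff hΛ k 0).2 (fun i j => U4Aux.pw_zero _)
    rwa [map_zero] at this
  have hzB : (0 : Module.End F (Fin 4 → F)) ∈ Bcent β := by
    change (0 : Module.End F (Fin 4 → F)) * β = β * 0
    rw [zero_mul, mul_zero]
  have hzP : (0 : Module.End F (Fin 4 → F)) ∈ Bperp β := by
    intro Z _
    rw [zero_mul, map_zero]
  have C' : U4Aux.Ctx T ⊥ m (m / 2 + 1) ((m + 1) / 2)
      {X | Matrix.toLin' X ∈ T.aFil Λ n ∩ Bcent β} J'grp := by
    refine ⟨hform, hunram.1, U4Aux.rprop_bot T, hm, by omega, by omega, by omega, by omega,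
      ?_, ?_, ?_⟩
    · intro X
      rw [hβ]
      exact U4Aux.hS_J' hΛ hn hy hy' hb _ _ X
    · change Matrix.toLin' 0 ∈ T.aFil Λ n ∩ Bcent β
      rw [map_zero]
      exact ⟨hz n, hzB⟩
    · intro k
      change _ ↔ Matrix.toLin' (U4Aux.mat T k - 1) ∈ T.aFil Λ n ∩ Bcent β
      rw [hsub, ← SetLike.mem_coe, hJ'grp]
      have e : T.toE k - 1 ∈ Bcent β ↔ T.toE k ∈ Bcent β := by
        change (T.toE k - 1) * β = β * (T.toE k - 1) ↔ T.toE k * β = β * T.toE k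
        rw [sub_mul, mul_sub, one_mul, mul_one, sub_left_inj]
      exact and_congr Iff.rfl e.symm
  have C : U4Aux.Ctx T (U4Aux.OO T) m (m / 2 + 1) ((m + 1) / 2)
      {X | Matrix.toLin' X ∈ T.frakJplus Λ n β} Jgrp := by
    refine ⟨hform, hunram.1, U4Aux.rprop_OO T, hm, by omega, by omega, by omega, by omega,
      ?_, ?_, ?_⟩
    · intro X
      rw [hβ]
      exact U4Aux.hS_J hΛ hn hy hy' hb X
    · change Matrix.toLin' 0 ∈ T.frakJplus Λ n β
      rw [map_zero]
      exact ⟨0, ⟨hz _, hzB⟩, 0, ⟨hz _, hzP⟩, (add_zero 0).symm⟩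
    · intro k
      change _ ↔ Matrix.toLin' (U4Aux.mat T k - 1) ∈ T.frakJplus Λ n β
      rw [hsub, ← SetLike.mem_coe, hJgrp]
      exact Iff.rfl
  have hN' : ∀ (g : T.GU) (t : ℕ), U4Aux.mat T g = U4Aux.dM T t →
      T.dcIndex J'grp g = (q ^ 2) ^ t := by
    intro g t hg
    obtain ⟨κ, f0, hf0, hκ⟩ := htr (2 * t)
    have ht : U4Aux.Trans T ⊥ (t : ℤ) (fun _ : PUnit.{w + 1} => (0 : F)) := by
      refine ⟨fun _ => rfl, ?_, fun _ _ _ => rfl⟩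
      intro x hx
      rw [AddSubgroup.mem_bot] at hx
      subst hx
      refine ⟨PUnit.unit, ?_⟩
      rw [sub_zero]
      exact U4Aux.pw_zero _
    rw [C'.index hU hg ht hf0, hκ, Nat.card_unique, one_pow, one_mul, pow_mul]
  have hN : ∀ (g : T.GU) (t : ℕ), U4Aux.mat T g = U4Aux.dM T t →
      T.dcIndex Jgrp g = (q ^ 6) ^ t := by
    intro g t hg
    obtain ⟨κ, f0, hf0, hκ⟩ := htr (2 * t)
    obtain ⟨ι, f1, hf1, hι⟩ := htr t
    rw [C.index hU hg (U4Aux.trans_OO hU hf1) hf0, hκ, Nat.card_prod, hι]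
    ring
  have hm1 := U4Aux.mat_of_toE hs₁
  have hm2 := U4Aux.mat_of_toE hs₂
  intro t
  obtain ⟨a1, a2, a3, a4⟩ := C'.final hm1 hm2 hN' t
  obtain ⟨b1, b2, b3, b4⟩ := C.final hm1 hm2 hN t
  simp only [← pow_mul] at a1 a2 a3 a4 b1 b2 b3 b4
  exact ⟨a1, a2, a3, a4, b1, b3, b2, b4⟩
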